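/- Suppose F ∈ F^ν_{A,B,I,M}(κ,γ) and the parameters κ, γ, D satisfy A − ((κ+1)I+κM)D − Iγ > 0 and 2π C₂(κ,γ,D) exp(2πκI/A)/(κB) ≤ D. Let Δ : ℝ → (0,D) be the unique 2π-periodic solution of dΔ/ds = C₂(κ,γ,D) + (∂_s F[δ_s⊗ν](s,ω_c)/F[δ_s⊗ν](s,ω_c)) Δ(s). Then the set C_ν^{(1)}(Δ) := {μ ∈ P₂^ν(ℝ²) : diam_x(supp μ) ≤ Δ(x_c[μ])} is positively invariant under the continuity equation; in particular, if μ₀ ∈ C_ν^{(1)}(Δ) then every measure-valued solution μ with initial datum μ₀ satisfies diam_x(supp μ_t) ≤ Δ(x_c[μ_t]) ≤ D for all t ≥ 0. -/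

import Mathlib

set_option autoImplicit false

open MeasureTheory Set Real Filter

noncomputable section

/-- The (topological) support of a measure: points all of whose open neighborhoods
have positive measure. -/
def msupp {E : Type*} [TopologicalSpace E] [MeasurableSpace E] (μ : Measure E) : Set E :=
  {z | ∀ U : Set E, IsOpen U → z ∈ U → μ U ≠ 0}

/-- `pl` is a coupling of `μ` and `ν`. -/
def IsCoupling {E F : Type*} [MeasurableSpace E] [MeasurableSpace F]
    (pl : Measure (E × F)) (μ : Measure E) (ν : Measure F) : Prop :=
  pl.map Prod.fst = μ ∧ pl.map Prod.snd = ν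

/-- The 1-Wasserstein distance. -/
def W1 {E : Type*} [MeasurableSpace E] [PseudoMetricSpace E] (μ ν : Measure E) : ℝ :=
  ⨅ pl : {pl : Measure (E × E) // IsCoupling pl μ ν}, ∫ q, dist q.1 q.2 ∂(pl.1)

/-- The 2-Wasserstein distance. -/
def W2 {E : Type*} [MeasurableSpace E] [PseudoMetricSpace E] (μ ν : Measure E) : ℝ :=
  ⨅ pl : {pl : Measure (E × E) // IsCoupling pl μ ν},
    Real.sqrt (∫ q, dist q.1 q.2 ^ 2 ∂(pl.1))

/-- Partial derivative `∂ₓ F[μ](x,ω)` of a nonlocal velocity field. -/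
def Fx (F : Measure (ℝ × ℝ) → ℝ × ℝ → ℝ) (μ : Measure (ℝ × ℝ)) (z : ℝ × ℝ) : ℝ :=
  deriv (fun x => F μ (x, z.2)) z.1

/-- Second partial derivative `∂ₓ² F[μ](x,ω)`. -/
def Fxx (F : Measure (ℝ × ℝ) → ℝ × ℝ → ℝ) (μ : Measure (ℝ × ℝ)) (z : ℝ × ℝ) : ℝ :=
  deriv (fun x => Fx F μ (x, z.2)) z.1

/-- Partial derivative `∂_ω F[μ](x,ω)`. -/
def Fw (F : Measure (ℝ × ℝ) → ℝ × ℝ → ℝ) (μ : Measure (ℝ × ℝ)) (z : ℝ × ℝ) : ℝ :=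
  deriv (fun w => F μ (z.1, w)) z.2

/-- The spatial average (barycenter) `x_c[μ] = ∫ x μ(dx,dω)`. -/
def xc (μ : Measure (ℝ × ℝ)) : ℝ := ∫ z, z.1 ∂μ

/-- The mean frequency `ω_c = ∫ ω ν(dω)`. -/
def wc (ν : Measure ℝ) : ℝ := ∫ ω, ω ∂ν

/-- The measure `δ_x ⊗ ν`. -/
def diracProd (x : ℝ) (ν : Measure ℝ) : Measure (ℝ × ℝ) := (Measure.dirac x).prod ν

/-- `P₂^ν(ℝ²)`: probability measures on `ℝ²` with finite second moment and
`ω`-marginal `ν`. -/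
def P2nu (ν : Measure ℝ) : Set (Measure (ℝ × ℝ)) :=
  {μ | IsProbabilityMeasure μ ∧ Integrable (fun z : ℝ × ℝ => z.1 ^ 2 + z.2 ^ 2) μ ∧
    μ.map Prod.snd = ν}

/-- The diameter in `x` of the support of `μ`. -/
def diamx (μ : Measure (ℝ × ℝ)) : ℝ :=
  sSup {d : ℝ | ∃ z ∈ msupp μ, ∃ z' ∈ msupp μ, d = |z.1 - z'.1|}

/-- The structural assumptions `(A1)–(A5)` defining the class `F^ν_{A,B,I,M}(κ,γ)`. -/
structure Framework (ν : Measure ℝ) (F : Measure (ℝ × ℝ) → ℝ × ℝ → ℝ)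
    (A B I M κ γ : ℝ) : Prop where
  /-- (A1) mean-field regularity -/
  hA1 : ∀ μ ∈ P2nu ν, ∀ μ' ∈ P2nu ν, ∀ x : ℝ, ∀ ω ∈ msupp ν,
    |F μ (x, ω) - F μ' (x, ω)| ≤ κ * M * W1 μ μ' ∧
    |Fx F μ (x, ω) - Fx F μ' (x, ω)| ≤ κ * M * W1 μ μ'
  /-- (A2) space regularity -/
  hA2 : ∀ μ ∈ P2nu ν, ContDiff ℝ 2 (F μ) ∧
    (∀ z : ℝ × ℝ, |Fx F μ z| ≤ κ * I) ∧ (∀ z : ℝ × ℝ, |Fxx F μ z| ≤ κ * I) ∧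
    (∀ z : ℝ × ℝ, |Fw F μ z| ≤ I)
  /-- (A3) lifted periodicity -/
  hA3 : ∀ μ ∈ P2nu ν, ∀ z : ℝ × ℝ,
    F (μ.map fun w : ℝ × ℝ => (w.1 + 2 * π, w.2)) (z.1 + 2 * π, z.2) = F μ z
  /-- (A4) no stationarity -/
  hA4 : ∀ x : ℝ, A ≤ F (diracProd x ν) (x, wc ν)
  /-- (A5) synchronization -/
  hA5 : (∫ x in (0:ℝ)..(2 * π),
      Fx F (diracProd x ν) (x, wc ν) / F (diracProd x ν) (x, wc ν)) ≤ -(κ * B)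

/-- `μ` is a measure-valued solution of the nonlocal continuity equation
`∂ₜ μ + ∂ₓ (F[μ] μ) = 0` on `[0,∞)`. -/
def IsSol (F : Measure (ℝ × ℝ) → ℝ × ℝ → ℝ) (μ : ℝ → Measure (ℝ × ℝ)) : Prop :=
  (∀ φ : ℝ × ℝ → ℝ, Continuous φ → HasCompactSupport φ →
    ContinuousOn (fun t => ∫ z, φ z ∂(μ t)) (Ici 0)) ∧
  (∀ φ : ℝ → ℝ × ℝ → ℝ,
    ContDiff ℝ 1 (fun q : ℝ × (ℝ × ℝ) => φ q.1 q.2) →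
    HasCompactSupport (fun q : ℝ × (ℝ × ℝ) => φ q.1 q.2) →
    ∀ t : ℝ, 0 ≤ t →
      ∫ z, φ t z ∂(μ t) = (∫ z, φ 0 z ∂(μ 0)) +
        ∫ s in (0:ℝ)..t, ∫ z, (deriv (fun u => φ u z) s +
          F (μ s) z * deriv (fun x => φ s (x, z.2)) z.1) ∂(μ s))

/-- `X` is the characteristic flow associated with a solution `μ`:
`dX/dt = F[μ_t](X(t,x,ω),ω)`, `X(0,x,ω) = x`. -/
def IsFlow (F : Measure (ℝ × ℝ) → ℝ × ℝ → ℝ) (μ : ℝ → Measure (ℝ × ℝ))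
    (X : ℝ → ℝ → ℝ → ℝ) : Prop :=
  (∀ x ω : ℝ, X 0 x ω = x) ∧
  ∀ x ω t : ℝ, 0 ≤ t → HasDerivAt (fun τ => X τ x ω) (F (μ t) (X t x ω, ω)) t

/-- `K` is a disintegration of `μ` with respect to the `ω`-marginal `ν`. -/
def IsDisint (ν : Measure ℝ) (μ : Measure (ℝ × ℝ)) (K : ℝ → Measure ℝ) : Prop :=
  (∀ ω, IsProbabilityMeasure (K ω)) ∧
  μ = ν.bind fun ω => (K ω).map fun x => (x, ω)

/-- The constant `C₁(κ,γ,D) = κ(M+I)D² + 2Iγ`. -/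
def C1 (I M κ γ D : ℝ) : ℝ := κ * (M + I) * D ^ 2 + 2 * I * γ

/-- The constant `C₂(κ,γ,D)`. -/
def C2 (A I M κ γ D : ℝ) : ℝ :=
  C1 I M κ γ D / A +
    (((κ + 1) * I + κ * M) * D + I * γ) * (κ * I * D + C1 I M κ γ D) /
      (A * (A - ((κ + 1) * I + κ * M) * D - I * γ))

/-- The constant `E₁(κ,γ,D) = κ (D (3I/2 + M) + Iγ)`. -/
def E1 (I M κ γ D : ℝ) : ℝ := κ * (D * (3 * I / 2 + M) + I * γ)

/-- The constant `E₂(κ,γ,D)`. -/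
def E2 (A I M κ γ D : ℝ) : ℝ :=
  κ / (A - ((κ + 1) * I + κ * M) * D - I * γ) *
    (D * (3 * I / 2 + M) + I * γ + I * (κ * (I + M) * D + I * γ) / A)

/-- Membership in `C_ν^{(1)}(Δ)`. -/
def MemC1 (ν : Measure ℝ) (Δ : ℝ → ℝ) (μ : Measure (ℝ × ℝ)) : Prop :=
  μ ∈ P2nu ν ∧ diamx μ ≤ Δ (xc μ)

/-- Membership in `C_ν(Δ,Δ̃)`. -/
def MemC (ν : Measure ℝ) (Δ Δ' : ℝ → ℝ) (μ : Measure (ℝ × ℝ)) : Prop :=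
  μ ∈ P2nu ν ∧ diamx μ ≤ Δ (xc μ) ∧
  ∃ K : ℝ → Measure ℝ, IsDisint ν μ K ∧
    ∀ ω ∈ msupp ν, ∀ ω' ∈ msupp ν, W2 (K ω) (K ω') ≤ Δ' (xc μ) * |ω - ω'|

/-- The metric `d₁` computed from disintegrations. -/
def d1k (ν : Measure ℝ) (K K' : ℝ → Measure ℝ) : ℝ := ∫ ω, W1 (K ω) (K' ω) ∂ν

/-- The metric `d₂` computed from disintegrations. -/
def d2k (ν : Measure ℝ) (K K' : ℝ → Measure ℝ) : ℝ :=
  Real.sqrt (∫ ω, W2 (K ω) (K' ω) ^ 2 ∂ν)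

lemma msupp_eq_support {E : Type*} [TopologicalSpace E] [MeasurableSpace E] (μ : Measure E) :
    msupp μ = μ.support := by
  ext z
  rw [Measure.mem_support_iff_forall]
  constructor
  · intro h U hU
    obtain ⟨V, hVU, hVo, hzV⟩ := mem_nhds_iff.1 hU
    exact (pos_iff_ne_zero.2 (h V hVo hzV)).trans_le (measure_mono hVU)
  · intro h U hU hz
    exact (h U (hU.mem_nhds hz)).ne'

lemma ae_mem_msupp {E : Type*} [TopologicalSpace E] [MeasurableSpace E]
    [HereditarilyLindelofSpace E] (μ : Measure E) : ∀ᵐ z ∂μ, z ∈ msupp μ := by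
  rw [msupp_eq_support]
  exact Measure.support_mem_ae

/-- A closed set of full measure contains the support. -/
lemma msupp_subset_of_ae {E : Type*} [TopologicalSpace E] [MeasurableSpace E] {μ : Measure E}
    {s : Set E} (hs : IsClosed s) (h : ∀ᵐ z ∂μ, z ∈ s) : msupp μ ⊆ s := by
  rw [msupp_eq_support]
  exact Measure.support_subset_of_isClosed hs h

/-- Chain rule in integral form: `Φ ∘ H` is the integral of its almost everywhere derivative when
`H` is an indefinite integral and `Φ` is Lipschitz on the range of `H`. -/
lemma integral_chain_rule {H p Φ φ' : ℝ → ℝ} {a b : ℝ} (hab : a ≤ b) {S : Set ℝ} {K : NNReal}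
    (hp : IntervalIntegrable p volume a b)
    (hH : ∀ t ∈ Icc a b, H t = H a + ∫ s in a..t, p s)
    (hS : ∀ t ∈ Icc a b, H t ∈ S) (hΦ : LipschitzOnWith K Φ S)
    (hd : ∀ t ∈ Icc a b, HasDerivAt Φ (φ' t) (H t)) :
    IntervalIntegrable (fun t => φ' t * p t) volume a b ∧
      Φ (H b) - Φ (H a) = ∫ t in a..b, φ' t * p t := by
  have hacI := hp.absolutelyContinuousOnInterval_intervalIntegral (c := a) left_mem_uIcc
  have hac : AbsolutelyContinuousOnInterval (fun t => Φ (H t)) a b := by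
    rw [absolutelyContinuousOnInterval_iff] at hacI ⊢
    intro ε hε
    obtain ⟨δ, hδ, h⟩ := hacI (ε / (K + 1)) (by positivity)
    refine ⟨δ, hδ, fun E hE hlt => ?_⟩
    have h1 := h E hE hlt
    have hb : ∑ i ∈ Finset.range E.1, dist (Φ (H (E.2 i).1)) (Φ (H (E.2 i).2)) ≤
        K * ∑ i ∈ Finset.range E.1, dist (∫ v in a..(E.2 i).1, p v) (∫ v in a..(E.2 i).2, p v) := by
      rw [Finset.mul_sum]
      refine Finset.sum_le_sum fun i hi => ?_
      have hm := hE.1 i hi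
      rw [uIcc_of_le hab] at hm
      refine (hΦ.dist_le_mul _ (hS _ hm.1) _ (hS _ hm.2)).trans (le_of_eq ?_)
      rw [hH _ hm.1, hH _ hm.2, dist_add_left]
    refine hb.trans_lt ?_
    have h2 : (K : ℝ) * (ε / (K + 1)) < ε := by
      have hK : (0 : ℝ) ≤ K := K.2
      rw [← mul_div_assoc, div_lt_iff₀ (by positivity)]
      nlinarith
    exact (mul_le_mul_of_nonneg_left h1.le K.2).trans_lt h2
  have hae : ∀ᵐ t, t ∈ uIoc a b → deriv (fun t => Φ (H t)) t = φ' t * p t := by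
    have hne : ∀ᵐ t : ℝ, t ≠ b := by simp [ae_iff, measure_singleton]
    filter_upwards [hp.ae_hasDerivAt_integral, hne] with t ht htb htm
    rw [uIoc_of_le hab] at htm
    have htI : t ∈ Icc a b := ⟨htm.1.le, htm.2⟩
    have h1 := ht (by rwa [uIcc_of_le hab]) a left_mem_uIcc
    have h2 : HasDerivAt H (p t) t := by
      refine (h1.const_add (H a)).congr_of_eventuallyEq ?_
      filter_upwards [Ioo_mem_nhds htm.1 (lt_of_le_of_ne htm.2 htb)] with s hs
      exact hH s ⟨hs.1.le, hs.2.le⟩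
    exact ((hd t htI).comp t h2).deriv
  constructor
  · refine hac.intervalIntegrable_deriv.congr_ae ?_
    exact (ae_restrict_iff' measurableSet_uIoc).2 hae
  · rw [← hac.integral_deriv_eq_sub]
    exact intervalIntegral.integral_congr_ae hae

/-- Boundedness of the `x`-projection of the support. -/
def XBdd (μ : Measure (ℝ × ℝ)) (L : ℝ) : Prop := ∀ᵐ z ∂μ, |z.1| ≤ L

lemma XBdd.abs_le_of_mem_msupp {μ : Measure (ℝ × ℝ)} {L : ℝ} (h : XBdd μ L) {z : ℝ × ℝ}
    (hz : z ∈ msupp μ) : |z.1| ≤ L :=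
  msupp_subset_of_ae (s := {z : ℝ × ℝ | |z.1| ≤ L})
    (isClosed_le (continuous_fst.abs) continuous_const) h hz

/-- The set of `x`-distances in the support. -/
def xDists (μ : Measure (ℝ × ℝ)) : Set ℝ :=
  {d : ℝ | ∃ z ∈ msupp μ, ∃ z' ∈ msupp μ, d = |z.1 - z'.1|}

lemma exists_XBdd_of_bddAbove {μ : Measure (ℝ × ℝ)} [IsProbabilityMeasure μ]
    (h : BddAbove (xDists μ)) : ∃ L, XBdd μ L := by
  obtain ⟨C, hC⟩ := h
  obtain ⟨z0, hz0⟩ := (ae_mem_msupp μ).exists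
  refine ⟨C + |z0.1|, ?_⟩
  filter_upwards [ae_mem_msupp μ] with z hz
  have h1 : |z.1 - z0.1| ≤ C := hC ⟨z, hz, z0, hz0, rfl⟩
  have h2 := abs_sub_abs_le_abs_sub z.1 z0.1
  linarith

lemma XBdd.bddAbove {μ : Measure (ℝ × ℝ)} {L : ℝ} (h : XBdd μ L) : BddAbove (xDists μ) := by
  refine ⟨L + L, ?_⟩
  rintro d ⟨z, hz, z', hz', rfl⟩
  exact (abs_sub _ _).trans (add_le_add (h.abs_le_of_mem_msupp hz) (h.abs_le_of_mem_msupp hz'))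

lemma diamx_eq_zero {μ : Measure (ℝ × ℝ)} (h : ¬ BddAbove (xDists μ)) : diamx μ = 0 :=
  Real.sSup_of_not_bddAbove h

lemma sub_le_diamx {μ : Measure (ℝ × ℝ)} (h : BddAbove (xDists μ)) {z z' : ℝ × ℝ}
    (hz : z ∈ msupp μ) (hz' : z' ∈ msupp μ) : z.1 - z'.1 ≤ diamx μ :=
  (le_abs_self _).trans (le_csSup h ⟨z, hz, z', hz', rfl⟩)

lemma diamx_le {μ : Measure (ℝ × ℝ)} [IsProbabilityMeasure μ] {c : ℝ}
    (h : ∀ z ∈ msupp μ, ∀ z' ∈ msupp μ, z.1 - z'.1 ≤ c) : diamx μ ≤ c := by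
  obtain ⟨z0, hz0⟩ := (ae_mem_msupp μ).exists
  refine csSup_le ⟨_, z0, hz0, z0, hz0, rfl⟩ ?_
  rintro d ⟨z, hz, z', hz', rfl⟩
  exact abs_le'.2 ⟨h z hz z' hz', by rw [neg_sub]; exact h z' hz' z hz⟩

lemma abs_sub_le_of_mem_msupp {ν : Measure ℝ} (hΩ : Bornology.IsBounded (msupp ν)) {γ : ℝ}
    (hγ : γ = sSup {d : ℝ | ∃ ω ∈ msupp ν, ∃ ω' ∈ msupp ν, d = |ω - ω'|}) {ω ω' : ℝ}
    (hω : ω ∈ msupp ν) (hω' : ω' ∈ msupp ν) : |ω - ω'| ≤ γ := by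
  rw [hγ]
  refine le_csSup ?_ ⟨ω, hω, ω', hω', rfl⟩
  obtain ⟨C, hC⟩ := hΩ.exists_norm_le
  refine ⟨C + C, ?_⟩
  rintro d ⟨w, hw, w', hw', rfl⟩
  exact (abs_sub _ _).trans (add_le_add (hC w hw) (hC w' hw'))

lemma integrable_id_of_isBounded {ν : Measure ℝ} [IsProbabilityMeasure ν]
    (hΩ : Bornology.IsBounded (msupp ν)) : Integrable (fun ω : ℝ => ω) ν := by
  obtain ⟨C, hC⟩ := hΩ.exists_norm_le
  refine Integrable.of_bound (by fun_prop) C ?_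
  filter_upwards [ae_mem_msupp ν] with ω hω using hC ω hω

lemma abs_sub_wc_le {ν : Measure ℝ} [IsProbabilityMeasure ν]
    (hΩ : Bornology.IsBounded (msupp ν)) {γ : ℝ}
    (hγ : γ = sSup {d : ℝ | ∃ ω ∈ msupp ν, ∃ ω' ∈ msupp ν, d = |ω - ω'|}) {ω : ℝ}
    (hω : ω ∈ msupp ν) : |ω - wc ν| ≤ γ := by
  have h1 : ω - wc ν = ∫ ω', (ω - ω') ∂ν := by
    rw [integral_sub (integrable_const _) (integrable_id_of_isBounded hΩ)]
    simp [wc]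
  rw [h1, ← Real.norm_eq_abs]
  have := norm_integral_le_of_norm_le_const (μ := ν) (f := fun ω' => ω - ω') (C := γ) (by
    filter_upwards [ae_mem_msupp ν] with ω' hω' using abs_sub_le_of_mem_msupp hΩ hγ hω hω')
  simpa using this

lemma ae_snd_mem_msupp {ν : Measure ℝ} {μ : Measure (ℝ × ℝ)} (hμ : μ ∈ P2nu ν) :
    ∀ᵐ z ∂μ, z.2 ∈ msupp ν := by
  have h := ae_mem_msupp ν
  conv at h => rw [← hμ.2.2]
  have := ae_of_ae_map (f := Prod.snd) (by fun_prop) h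
  simpa only [hμ.2.2] using this

lemma integrable_fst_of_mem {ν : Measure ℝ} {μ : Measure (ℝ × ℝ)} (hμ : μ ∈ P2nu ν) :
    Integrable (fun z : ℝ × ℝ => z.1) μ := by
  have := hμ.1
  refine ((hμ.2.1).add (integrable_const (1 : ℝ))).mono' (by fun_prop) ?_
  filter_upwards with z
  simp only [Pi.add_apply, Real.norm_eq_abs]
  nlinarith [sq_abs z.1, sq_nonneg z.2, sq_nonneg (|z.1| - 1), abs_nonneg z.1]

lemma diracProd_eq_map (x : ℝ) (ν : Measure ℝ) [IsProbabilityMeasure ν] :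
    diracProd x ν = ν.map (fun ω => (x, ω)) := Measure.dirac_prod x

lemma diracProd_mem {ν : Measure ℝ} [IsProbabilityMeasure ν]
    (hΩ : Bornology.IsBounded (msupp ν)) (x : ℝ) : diracProd x ν ∈ P2nu ν := by
  have hm : Measurable (fun ω : ℝ => (x, ω)) := by fun_prop
  refine ⟨?_, ?_, ?_⟩
  · unfold diracProd; infer_instance
  · rw [diracProd_eq_map, integrable_map_measure (by fun_prop) hm.aemeasurable]
    obtain ⟨C, hC⟩ := hΩ.exists_norm_le
    refine Integrable.of_bound (by fun_prop) (x ^ 2 + C ^ 2) ?_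
    filter_upwards [ae_mem_msupp ν] with ω hω
    have h1 : |ω| ≤ C := hC ω hω
    have h2 : ω ^ 2 ≤ C ^ 2 := by
      rw [← sq_abs ω]; gcongr
    simp only [Function.comp_apply, Real.norm_eq_abs]
    rw [abs_of_nonneg (by positivity)]
    linarith
  · rw [diracProd_eq_map, Measure.map_map measurable_snd hm]
    exact Measure.map_id

lemma W1_diracProd_le {ν : Measure ℝ} [IsProbabilityMeasure ν] {μ : Measure (ℝ × ℝ)}
    (hμ : μ ∈ P2nu ν) (x : ℝ) : W1 μ (diracProd x ν) ≤ ∫ z, |z.1 - x| ∂μ := by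
  have hm : Measurable (fun z : ℝ × ℝ => (z, ((x, z.2) : ℝ × ℝ))) := by fun_prop
  have hc : IsCoupling (μ.map fun z : ℝ × ℝ => (z, ((x, z.2) : ℝ × ℝ))) μ (diracProd x ν) := by
    constructor
    · rw [Measure.map_map measurable_fst hm]
      exact Measure.map_id
    · rw [Measure.map_map measurable_snd hm, diracProd_eq_map, ← hμ.2.2,
        Measure.map_map (by fun_prop) measurable_snd]
      rfl
  have hb : BddBelow (range fun pl : {pl : Measure ((ℝ × ℝ) × (ℝ × ℝ)) //
      IsCoupling pl μ (diracProd x ν)} => ∫ q, dist q.1 q.2 ∂(pl.1)) := by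
    refine ⟨0, ?_⟩
    rintro _ ⟨pl, rfl⟩
    exact integral_nonneg fun q => dist_nonneg
  refine (ciInf_le hb ⟨_, hc⟩).trans (le_of_eq ?_)
  simp only
  rw [integral_map hm.aemeasurable (by fun_prop)]
  refine integral_congr_ae (Eventually.of_forall fun z => ?_)
  simp [Prod.dist_eq, Real.dist_eq]

lemma W1_diracProd_le_of_ae {ν : Measure ℝ} [IsProbabilityMeasure ν] {μ : Measure (ℝ × ℝ)}
    (hμ : μ ∈ P2nu ν) {x r : ℝ} (h : ∀ᵐ z ∂μ, |z.1 - x| ≤ r) : W1 μ (diracProd x ν) ≤ r := by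
  have := hμ.1
  refine (W1_diracProd_le hμ x).trans ?_
  have := integral_mono_ae (μ := μ) ((integrable_fst_of_mem hμ).sub (integrable_const x)).abs
    (integrable_const r) h
  simpa using this

lemma abs_sub_le_of_abs_deriv_le {f f' : ℝ → ℝ} {C : ℝ} {s : Set ℝ} (hs : Convex ℝ s)
    (hf : ∀ x ∈ s, HasDerivAt f (f' x) x) (hb : ∀ x ∈ s, |f' x| ≤ C) {x y : ℝ} (hx : x ∈ s)
    (hy : y ∈ s) : |f x - f y| ≤ C * |x - y| :=
  hs.norm_image_sub_le_of_norm_hasDerivWithin_le (fun z hz => (hf z hz).hasDerivWithinAt) hb hy hx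

namespace Framework

variable {ν : Measure ℝ} {F : Measure (ℝ × ℝ) → ℝ × ℝ → ℝ} {A B I M κ γ : ℝ}

lemma contDiff_fst (hF : Framework ν F A B I M κ γ) {μ : Measure (ℝ × ℝ)} (hμ : μ ∈ P2nu ν)
    (ω : ℝ) : ContDiff ℝ 2 (fun x => F μ (x, ω)) :=
  (hF.hA2 μ hμ).1.comp (by fun_prop)

lemma hasDerivAt_fst (hF : Framework ν F A B I M κ γ) {μ : Measure (ℝ × ℝ)} (hμ : μ ∈ P2nu ν)
    (x ω : ℝ) : HasDerivAt (fun x => F μ (x, ω)) (Fx F μ (x, ω)) x :=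
  ((hF.contDiff_fst hμ ω).differentiable (by norm_num) x).hasDerivAt

lemma hasDerivAt_snd (hF : Framework ν F A B I M κ γ) {μ : Measure (ℝ × ℝ)} (hμ : μ ∈ P2nu ν)
    (x ω : ℝ) : HasDerivAt (fun ω => F μ (x, ω)) (Fw F μ (x, ω)) ω := by
  have h : ContDiff ℝ 2 (fun ω => F μ (x, ω)) := (hF.hA2 μ hμ).1.comp (by fun_prop)
  exact (h.differentiable (by norm_num) ω).hasDerivAt

lemma hasDerivAt_Fx (hF : Framework ν F A B I M κ γ) {μ : Measure (ℝ × ℝ)} (hμ : μ ∈ P2nu ν)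
    (x ω : ℝ) : HasDerivAt (fun x => Fx F μ (x, ω)) (Fxx F μ (x, ω)) x := by
  have h2 : ContDiff ℝ (1 + 1) (fun x => F μ (x, ω)) := by
    rw [one_add_one_eq_two]
    exact hF.contDiff_fst hμ ω
  have h : ContDiff ℝ 1 (deriv fun x => F μ (x, ω)) := (contDiff_succ_iff_deriv.1 h2).2.2
  exact (h.differentiable (by norm_num) x).hasDerivAt

lemma continuous (hF : Framework ν F A B I M κ γ) {μ : Measure (ℝ × ℝ)} (hμ : μ ∈ P2nu ν) :
    Continuous (F μ) := (hF.hA2 μ hμ).1.continuous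

lemma abs_sub_fst_le (hF : Framework ν F A B I M κ γ) {μ : Measure (ℝ × ℝ)} (hμ : μ ∈ P2nu ν)
    (x x' ω : ℝ) : |F μ (x, ω) - F μ (x', ω)| ≤ κ * I * |x - x'| :=
  abs_sub_le_of_abs_deriv_le convex_univ (fun x _ => hF.hasDerivAt_fst hμ x ω)
    (fun x _ => (hF.hA2 μ hμ).2.1 (x, ω)) (mem_univ x) (mem_univ x')

lemma abs_sub_snd_le (hF : Framework ν F A B I M κ γ) {μ : Measure (ℝ × ℝ)} (hμ : μ ∈ P2nu ν)
    (x ω ω' : ℝ) : |F μ (x, ω) - F μ (x, ω')| ≤ I * |ω - ω'| :=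
  abs_sub_le_of_abs_deriv_le convex_univ (fun w _ => hF.hasDerivAt_snd hμ x w)
    (fun w _ => (hF.hA2 μ hμ).2.2.2 (x, w)) (mem_univ ω) (mem_univ ω')

lemma abs_Fx_sub_le (hF : Framework ν F A B I M κ γ) {μ : Measure (ℝ × ℝ)} (hμ : μ ∈ P2nu ν)
    (x x' ω : ℝ) : |Fx F μ (x, ω) - Fx F μ (x', ω)| ≤ κ * I * |x - x'| :=
  abs_sub_le_of_abs_deriv_le convex_univ (fun x _ => hF.hasDerivAt_Fx hμ x ω)
    (fun x _ => (hF.hA2 μ hμ).2.2.1 (x, ω)) (mem_univ x) (mem_univ x')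

/-- Comparison of the velocity field of `μ` with its value at a reference point `c`. -/
lemma abs_sub_diracProd_le [IsProbabilityMeasure ν] (hF : Framework ν F A B I M κ γ)
    (hΩ : Bornology.IsBounded (msupp ν))
    (hγ : γ = sSup {d : ℝ | ∃ ω ∈ msupp ν, ∃ ω' ∈ msupp ν, d = |ω - ω'|})
    (hI : 0 < I) (hM : 0 < M) (hκ : 0 < κ)
    {μ : Measure (ℝ × ℝ)} (hμ : μ ∈ P2nu ν) {c r : ℝ} (hW : W1 μ (diracProd c ν) ≤ r)
    {x ω : ℝ} (hx : |x - c| ≤ r) (hω : ω ∈ msupp ν) :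
    |F μ (x, ω) - F (diracProd c ν) (c, wc ν)| ≤ κ * M * r + κ * I * r + I * γ := by
  have hδ := diracProd_mem hΩ c
  have h1 := (hF.hA1 μ hμ _ hδ x ω hω).1
  have h2 := hF.abs_sub_fst_le hδ x c ω
  have h3 := hF.abs_sub_snd_le hδ c ω (wc ν)
  have h4 : κ * M * W1 μ (diracProd c ν) ≤ κ * M * r := by gcongr
  have h5 : κ * I * |x - c| ≤ κ * I * r := by gcongr
  have h6 : I * |ω - wc ν| ≤ I * γ := by gcongr; exact abs_sub_wc_le hΩ hγ hω
  have e : F μ (x, ω) - F (diracProd c ν) (c, wc ν) =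
    (F μ (x, ω) - F (diracProd c ν) (x, ω)) +
    (F (diracProd c ν) (x, ω) - F (diracProd c ν) (c, ω)) +
    (F (diracProd c ν) (c, ω) - F (diracProd c ν) (c, wc ν)) := by ring
  rw [e]
  refine (abs_add_three _ _ _).trans ?_
  linarith

/-- Linearization of the velocity difference around the reference point `c`, for points with
frequencies `ω, ω'` and an auxiliary frequency `η` at which the fields are compared. -/
lemma abs_pair_sub_le_aux [IsProbabilityMeasure ν] (hF : Framework ν F A B I M κ γ)
    (hΩ : Bornology.IsBounded (msupp ν))
    (hI : 0 < I) (hM : 0 < M) (hκ : 0 < κ)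
    {μ : Measure (ℝ × ℝ)} (hμ : μ ∈ P2nu ν) {c r : ℝ} (hW : W1 μ (diracProd c ν) ≤ r)
    {x x' ω ω' η : ℝ} (hx : |x - c| ≤ r) (hx' : |x' - c| ≤ r) (hη : η ∈ msupp ν) :
    |F μ (x, ω) - F μ (x', ω') - Fx F (diracProd c ν) (c, wc ν) * (x - x')| ≤
      κ * (M + I) * r * |x - x'| + I * (|ω - η| + |ω' - η| + 2 * |η - wc ν|) := by
  set δ := diracProd c ν with hδdef
  have hδ : δ ∈ P2nu ν := diracProd_mem hΩ c
  set g := Fx F δ (c, wc ν)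
  have t1 := hF.abs_sub_snd_le hμ x ω η
  have t2 := hF.abs_sub_snd_le hμ x' ω' η
  have t3 : |(F μ (x, η) - F δ (x, η)) - (F μ (x', η) - F δ (x', η))| ≤
      κ * M * r * |x - x'| :=
    abs_sub_le_of_abs_deriv_le (f := fun y => F μ (y, η) - F δ (y, η)) convex_univ
      (fun y _ => (hF.hasDerivAt_fst hμ y η).sub (hF.hasDerivAt_fst hδ y η))
      (fun y _ => (hF.hA1 μ hμ δ hδ y η hη).2.trans (by gcongr)) (mem_univ x) (mem_univ x')
  have t4 := hF.abs_sub_snd_le hδ x η (wc ν)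
  have t4' := hF.abs_sub_snd_le hδ x' η (wc ν)
  have t5 : |(F δ (x, wc ν) - g * x) - (F δ (x', wc ν) - g * x')| ≤ κ * I * r * |x - x'| := by
    refine abs_sub_le_of_abs_deriv_le (f := fun y => F δ (y, wc ν) - g * y)
      (s := Metric.closedBall c r) (f' := fun y => Fx F δ (y, wc ν) - g)
      (convex_closedBall c r) (fun y _ => ?_) (fun y hy => ?_) hx hx'
    · have h := (hF.hasDerivAt_fst hδ y (wc ν)).fun_sub ((hasDerivAt_id' y).const_mul g)
      rwa [mul_one] at h
    · refine (hF.abs_Fx_sub_le hδ y c (wc ν)).trans ?_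
      have : |y - c| ≤ r := hy
      gcongr
  rw [abs_le] at *
  constructor <;> nlinarith [t1.1, t1.2, t2.1, t2.2, t3.1, t3.2, t4.1, t4.2, t4'.1, t4'.2, t5.1,
    t5.2]

lemma abs_pair_sub_le [IsProbabilityMeasure ν] (hF : Framework ν F A B I M κ γ)
    (hΩ : Bornology.IsBounded (msupp ν))
    (hγ : γ = sSup {d : ℝ | ∃ ω ∈ msupp ν, ∃ ω' ∈ msupp ν, d = |ω - ω'|})
    (hI : 0 < I) (hM : 0 < M) (hκ : 0 < κ)
    {μ : Measure (ℝ × ℝ)} (hμ : μ ∈ P2nu ν) {c r : ℝ} (hW : W1 μ (diracProd c ν) ≤ r)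
    {x x' ω ω' : ℝ} (hx : |x - c| ≤ r) (hx' : |x' - c| ≤ r) (hxx' : |x - x'| ≤ r)
    (hω : ω ∈ msupp ν) (hω' : ω' ∈ msupp ν) :
    |F μ (x, ω) - F μ (x', ω') - Fx F (diracProd c ν) (c, wc ν) * (x - x')| ≤
      C1 I M κ γ r := by
  have h1 := hF.abs_pair_sub_le_aux hΩ hI hM hκ hμ hW (ω := ω) (ω' := ω') hx hx' hω
  have h2 := hF.abs_pair_sub_le_aux hΩ hI hM hκ hμ hW (ω := ω) (ω' := ω') hx hx' hω'
  have hr : 0 ≤ r := (abs_nonneg _).trans hx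
  have hk : κ * (M + I) * r * |x - x'| ≤ κ * (M + I) * r ^ 2 := by
    rw [pow_two, ← mul_assoc]; gcongr
  have a1 := abs_sub_wc_le hΩ hγ hω
  have a2 := abs_sub_wc_le hΩ hγ hω'
  have a3 := abs_sub_le_of_mem_msupp hΩ hγ hω hω'
  have key : |ω' - ω| + 2 * |ω - wc ν| ≤ 2 * γ ∨ |ω - ω'| + 2 * |ω' - wc ν| ≤ 2 * γ := by
    rw [abs_sub_comm ω' ω]
    generalize wc ν = m at *
    rcases abs_cases (ω - ω') with h | h <;> rcases abs_cases (ω - m) with h' | h' <;>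
      rcases abs_cases (ω' - m) with h'' | h'' <;>
      by_contra! hc <;> linarith [hc.1, hc.2]
  unfold C1
  rcases key with key | key
  · refine h1.trans ?_
    rw [sub_self, abs_zero]
    nlinarith
  · refine h2.trans ?_
    rw [sub_self, abs_zero]
    nlinarith

end Framework

section

/-- A smooth compactly supported function on `ℝ` equal to `1` on `[-|R| - 1, |R| + 1]`. -/
def cutoff (R : ℝ) : ContDiffBump (0 : ℝ) := ⟨|R| + 1, |R| + 2, by positivity, by linarith⟩

lemma cutoff_eq_one {R x : ℝ} (h : |x| ≤ R + 1) : cutoff R x = 1 := by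
  refine (cutoff R).one_of_mem_closedBall ?_
  rw [mem_closedBall_zero_iff, Real.norm_eq_abs]
  exact h.trans (add_le_add (le_abs_self R) le_rfl)

lemma deriv_cutoff_eq_zero {R x : ℝ} (h : |x| ≤ R) : deriv (cutoff R) x = 0 := by
  have : (cutoff R : ℝ → ℝ) =ᶠ[nhds x] fun _ => 1 := by
    filter_upwards [(isOpen_lt continuous_abs continuous_const).mem_nhds
      (show |x| < R + 1 by linarith)] with y hy
    exact cutoff_eq_one (le_of_lt hy)
  rw [this.deriv_eq, deriv_const]

lemma hasCompactSupport_mul_prod {X Y : Type*} [TopologicalSpace X] [TopologicalSpace Y]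
    [R1Space X] [R1Space Y]     {f : X → ℝ} {g : Y → ℝ} (hf : HasCompactSupport f)
    (hg : HasCompactSupport g) : HasCompactSupport fun z : X × Y => f z.1 * g z.2 := by
  refine HasCompactSupport.of_support_subset_isCompact (hf.isCompact.prod hg.isCompact) ?_
  intro z hz
  have hz' : f z.1 * g z.2 ≠ 0 := hz
  exact ⟨subset_tsupport _ (left_ne_zero_of_mul hz'), subset_tsupport _ (right_ne_zero_of_mul hz')⟩

variable {ν : Measure ℝ} {F : Measure (ℝ × ℝ) → ℝ × ℝ → ℝ} {A B I M κ γ : ℝ}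

lemma exists_radius (hΩ : Bornology.IsBounded (msupp ν)) :
    ∃ C, ∀ ω ∈ msupp ν, |ω| ≤ C := hΩ.exists_norm_le

lemma integrable_of_continuous_fst {μ : Measure (ℝ × ℝ)} [IsFiniteMeasure μ] {ψ : ℝ → ℝ}
    (hψ : Continuous ψ) (hs : HasCompactSupport ψ) : Integrable (fun z : ℝ × ℝ => ψ z.1) μ := by
  obtain ⟨C, hC⟩ := hs.exists_bound_of_continuous hψ
  exact Integrable.of_bound (by fun_prop) C (Eventually.of_forall fun z => hC z.1)

lemma Framework.integrable_mul (hF : Framework ν F A B I M κ γ)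
    (hΩ : Bornology.IsBounded (msupp ν)) {μ μ' : Measure (ℝ × ℝ)} (hμ : μ ∈ P2nu ν)
    (hμ' : μ' ∈ P2nu ν) {ψ : ℝ → ℝ}
    (hψ : Continuous ψ) (hs : HasCompactSupport ψ) :
    Integrable (fun z => F μ z * ψ z.1) μ' := by
  have := hμ'.1
  obtain ⟨R, hR⟩ := exists_radius hΩ
  have hc := hasCompactSupport_mul_prod hs (cutoff R).hasCompactSupport
  have hc' : HasCompactSupport fun z : ℝ × ℝ => F μ z * (ψ z.1 * cutoff R z.2) := hc.mul_left
  have hcont : Continuous fun z : ℝ × ℝ => F μ z * (ψ z.1 * cutoff R z.2) :=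
    (hF.continuous hμ).mul ((hψ.comp continuous_fst).mul
      ((cutoff R).continuous.comp continuous_snd))
  refine (hcont.integrable_of_hasCompactSupport hc').congr ?_
  filter_upwards [ae_snd_mem_msupp hμ'] with z hz
  rw [cutoff_eq_one ((hR _ hz).trans (by linarith)), mul_one]

lemma IsSol.continuousOn_integral {μ : ℝ → Measure (ℝ × ℝ)} (hsol : IsSol F μ)
    (hP : ∀ t : ℝ, 0 ≤ t → μ t ∈ P2nu ν) (hΩ : Bornology.IsBounded (msupp ν)) {ψ : ℝ → ℝ}
    (hψ : Continuous ψ) (hs : HasCompactSupport ψ) :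
    ContinuousOn (fun t => ∫ z, ψ z.1 ∂(μ t)) (Ici 0) := by
  obtain ⟨R, hR⟩ := exists_radius hΩ
  refine (hsol.1 (fun z : ℝ × ℝ => ψ z.1 * cutoff R z.2)
    ((hψ.comp continuous_fst).mul ((cutoff R).continuous.comp continuous_snd))
    (hasCompactSupport_mul_prod hs (cutoff R).hasCompactSupport)).congr fun t ht => ?_
  refine integral_congr_ae ?_
  filter_upwards [ae_snd_mem_msupp (hP t ht)] with z hz
  rw [cutoff_eq_one ((hR _ hz).trans (by linarith)), mul_one]

/-- The weak formulation tested with a product of a function of time and a function of `x`. -/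
lemma IsSol.weak_mul {μ : ℝ → Measure (ℝ × ℝ)} (hsol : IsSol F μ)
    (hF : Framework ν F A B I M κ γ)
    (hP : ∀ t : ℝ, 0 ≤ t → μ t ∈ P2nu ν) (hΩ : Bornology.IsBounded (msupp ν)) {ψ θ : ℝ → ℝ}
    (hψ : ContDiff ℝ 1 ψ) (hs : HasCompactSupport ψ) (hθ : ContDiff ℝ 1 θ)
    (hθs : HasCompactSupport θ) {t : ℝ} (ht : 0 ≤ t) :
    θ t * ∫ z, ψ z.1 ∂(μ t) = θ 0 * (∫ z, ψ z.1 ∂(μ 0)) +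
      ∫ s in (0 : ℝ)..t, (deriv θ s * (∫ z, ψ z.1 ∂(μ s)) +
        θ s * ∫ z, F (μ s) z * deriv ψ z.1 ∂(μ s)) := by
  obtain ⟨R, hR⟩ := exists_radius hΩ
  have hχ : ContDiff ℝ 1 (cutoff R : ℝ → ℝ) := (cutoff R).contDiff
  have hcs := hasCompactSupport_mul_prod hθs
    (hasCompactSupport_mul_prod hs (cutoff R).hasCompactSupport)
  have hcd : ContDiff ℝ 1 fun q : ℝ × (ℝ × ℝ) => θ q.1 * (ψ q.2.1 * cutoff R q.2.2) :=
    (hθ.comp contDiff_fst).mul ((hψ.comp (contDiff_fst.comp contDiff_snd)).mul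
      (hχ.comp (contDiff_snd.comp contDiff_snd)))
  have key := hsol.2 (fun s z => θ s * (ψ z.1 * cutoff R z.2)) hcd hcs t ht
  have hc : ∀ s, 0 ≤ s → ∀ᵐ z ∂(μ s), cutoff R z.2 = 1 := fun s hs => by
    filter_upwards [ae_snd_mem_msupp (hP s hs)] with z hz
    exact cutoff_eq_one ((hR _ hz).trans (by linarith))
  have e : ∀ s, 0 ≤ s → ∫ z, θ s * (ψ z.1 * cutoff R z.2) ∂(μ s) =
      θ s * ∫ z, ψ z.1 ∂(μ s) := fun s hs => by
    rw [← integral_const_mul]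
    refine integral_congr_ae ?_
    filter_upwards [hc s hs] with z hz
    rw [hz, mul_one]
  rw [e t ht, e 0 le_rfl] at key
  rw [key]
  congr 1
  refine intervalIntegral.integral_congr fun s hs' => ?_
  rw [uIcc_of_le ht] at hs'
  have hPs := hP s hs'.1
  have := hPs.1
  simp only
  rw [← integral_const_mul, ← integral_const_mul, ← integral_add
    ((integrable_of_continuous_fst hψ.continuous hs).const_mul _)
    ((hF.integrable_mul hΩ hPs hPs (hψ.continuous_deriv le_rfl) hs.deriv).const_mul _)]
  refine integral_congr_ae ?_
  filter_upwards [hc s hs'.1] with z hz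
  have d1 : deriv (fun u => θ u * (ψ z.1 * cutoff R z.2)) s = deriv θ s * ψ z.1 := by
    rw [hz, mul_one, deriv_mul_const_field]
  have d2 : deriv (fun x => θ s * (ψ x * cutoff R z.2)) z.1 = θ s * deriv ψ z.1 := by
    simp only [hz, mul_one]
    rw [deriv_const_mul_field]
  rw [d1, d2]
  ring

/-- If the spatial part of the weak formulation is not integrable in time, the weak formulation
forces the initial value to vanish. -/
lemma IsSol.weak_aux {μ : ℝ → Measure (ℝ × ℝ)} (hsol : IsSol F μ)
    (hF : Framework ν F A B I M κ γ)
    (hP : ∀ t : ℝ, 0 ≤ t → μ t ∈ P2nu ν) (hΩ : Bornology.IsBounded (msupp ν)) {ψ : ℝ → ℝ}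
    (hψ : ContDiff ℝ 1 ψ) (hs : HasCompactSupport ψ) {t : ℝ} (ht : 0 ≤ t) :
    ((∫ z, ψ z.1 ∂(μ t)) = (∫ z, ψ z.1 ∂(μ 0)) +
      ∫ s in (0 : ℝ)..t, ∫ z, F (μ s) z * deriv ψ z.1 ∂(μ s)) ∧
    (¬ IntervalIntegrable (fun s => ∫ z, F (μ s) z * deriv ψ z.1 ∂(μ s)) volume 0 t →
      (∫ z, ψ z.1 ∂(μ 0)) = 0) := by
  set h := fun s => ∫ z, ψ z.1 ∂(μ s) with hh
  set f := fun s => ∫ z, F (μ s) z * deriv ψ z.1 ∂(μ s) with hf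
  have hcut : ContDiff ℝ 1 (cutoff t : ℝ → ℝ) := (cutoff t).contDiff
  have hone : ∀ s ∈ Icc 0 t, cutoff t s = 1 := fun s hs => cutoff_eq_one (by
    rw [abs_of_nonneg hs.1]; linarith [hs.2])
  have hder : ∀ s ∈ Icc 0 t, deriv (cutoff t) s = 0 := fun s hs => deriv_cutoff_eq_zero (by
    rw [abs_of_nonneg hs.1]; exact hs.2)
  have e1 : h t = h 0 + ∫ s in (0 : ℝ)..t, f s := by
    have := hsol.weak_mul hF hP hΩ hψ hs hcut (cutoff t).hasCompactSupport ht
    rw [hone t ⟨ht, le_rfl⟩, hone 0 ⟨le_rfl, ht⟩, one_mul, one_mul] at this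
    rw [hh]
    simp only
    rw [this]
    congr 1
    refine intervalIntegral.integral_congr fun s hs' => ?_
    rw [uIcc_of_le ht] at hs'
    simp only [hone s hs', hder s hs', zero_mul, zero_add, one_mul, hf]
  refine ⟨e1, fun hni => ?_⟩
  have e2 : (1 + t) * h t = h 0 + ∫ s in (0 : ℝ)..t, (h s + (1 + s) * f s) := by
    have := hsol.weak_mul hF hP hΩ hψ hs (θ := fun s => (1 + s) * cutoff t s) (by fun_prop)
      ((cutoff t).hasCompactSupport.mul_left) ht
    rw [hone t ⟨ht, le_rfl⟩, hone 0 ⟨le_rfl, ht⟩, mul_one, mul_one, add_zero, one_mul] at this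
    rw [hh]
    simp only
    rw [this]
    congr 1
    refine intervalIntegral.integral_congr fun s hs' => ?_
    rw [uIcc_of_le ht] at hs'
    have d : deriv (fun s => (1 + s) * cutoff t s) s = 1 := by
      have h1 : HasDerivAt (fun s : ℝ => 1 + s) 1 s := (hasDerivAt_id' s).const_add 1
      have h2 : HasDerivAt (cutoff t) (deriv (cutoff t) s) s :=
        ((hcut.differentiable (by norm_num)) s).hasDerivAt
      rw [(h1.fun_mul h2).deriv, hone s hs', hder s hs']
      ring
    simp only [hone s hs', d, one_mul, mul_one, hf]
  have hhc : IntervalIntegrable h volume 0 t := by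
    refine ContinuousOn.intervalIntegrable ?_
    rw [uIcc_of_le ht]
    exact (hsol.continuousOn_integral hP hΩ hψ.continuous hs).mono fun s hs => hs.1
  have hni2 : ¬ IntervalIntegrable (fun s => h s + (1 + s) * f s) volume 0 t := by
    intro h1
    have h2 : IntervalIntegrable (fun s => (1 + s) * f s) volume 0 t := by
      refine (h1.sub hhc).congr fun s _ => ?_
      simp
    refine hni ((h2.continuousOn_mul (g := fun s => (1 + s)⁻¹) ?_).congr fun s hs' => ?_)
    · refine ContinuousOn.inv₀ (by fun_prop) fun s hs' => ?_
      rw [uIcc_of_le ht] at hs'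
      linarith [hs'.1]
    · rw [uIoc_of_le ht] at hs'
      have : 1 + s ≠ 0 := by linarith [hs'.1]
      field_simp
  rw [intervalIntegral.integral_undef hni, add_zero] at e1
  rw [intervalIntegral.integral_undef hni2, add_zero, e1] at e2
  have ht' : t ≠ 0 := by
    rintro rfl
    exact hni IntervalIntegrable.refl
  have : t * h 0 = 0 := by linarith
  exact (mul_eq_zero.1 this).resolve_left ht'

lemma exists_integral_cutoff_pos (μ : Measure (ℝ × ℝ)) [IsProbabilityMeasure μ] :
    ∃ R : ℝ, 0 < ∫ z, cutoff R z.1 ∂μ := by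
  by_contra! hc
  have h0 : ∀ n : ℕ, ∀ᵐ z ∂μ, cutoff n z.1 = 0 := fun n => by
    have h1 : 0 ≤ᵐ[μ] fun z : ℝ × ℝ => cutoff (n : ℝ) z.1 :=
      Eventually.of_forall fun z => (cutoff (n : ℝ)).nonneg
    have hi : Integrable (fun z : ℝ × ℝ => cutoff (n : ℝ) z.1) μ :=
      integrable_of_continuous_fst (cutoff (n : ℝ)).continuous (cutoff (n : ℝ)).hasCompactSupport
    have := (integral_eq_zero_iff_of_nonneg_ae h1 hi).1 (le_antisymm (hc n) (integral_nonneg_of_ae h1))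
    exact this
  obtain ⟨z, hz⟩ := (ae_all_iff.2 h0).exists
  obtain ⟨n, hn⟩ := exists_nat_ge |z.1|
  have := hz n
  rw [cutoff_eq_one (by linarith)] at this
  exact one_ne_zero this

/-- The weak formulation for functions of `x`, including the time integrability. -/
lemma IsSol.weak {μ : ℝ → Measure (ℝ × ℝ)} (hsol : IsSol F μ)
    (hF : Framework ν F A B I M κ γ)
    (hP : ∀ t : ℝ, 0 ≤ t → μ t ∈ P2nu ν) (hΩ : Bornology.IsBounded (msupp ν)) {ψ : ℝ → ℝ}
    (hψ : ContDiff ℝ 1 ψ) (hs : HasCompactSupport ψ) {t : ℝ} (ht : 0 ≤ t) :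
    IntervalIntegrable (fun s => ∫ z, F (μ s) z * deriv ψ z.1 ∂(μ s)) volume 0 t ∧
    (∫ z, ψ z.1 ∂(μ t)) = (∫ z, ψ z.1 ∂(μ 0)) +
      ∫ s in (0 : ℝ)..t, ∫ z, F (μ s) z * deriv ψ z.1 ∂(μ s) := by
  refine ⟨?_, (hsol.weak_aux hF hP hΩ hψ hs ht).1⟩
  by_contra hni
  have h0 := (hsol.weak_aux hF hP hΩ hψ hs ht).2 hni
  have := (hP 0 le_rfl).1
  obtain ⟨R, hR⟩ := exists_integral_cutoff_pos (μ 0)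
  have hχ : ContDiff ℝ 1 (cutoff R : ℝ → ℝ) := (cutoff R).contDiff
  have hχs := (cutoff R).hasCompactSupport
  have h1 : IntervalIntegrable (fun s => ∫ z, F (μ s) z * deriv (cutoff R) z.1 ∂(μ s))
      volume 0 t := by
    by_contra hni'
    exact hR.ne' ((hsol.weak_aux hF hP hΩ hχ hχs ht).2 hni')
  have h2 : IntervalIntegrable (fun s => ∫ z, F (μ s) z * deriv (fun x => ψ x + cutoff R x) z.1
      ∂(μ s)) volume 0 t := by
    by_contra hni'
    have := (hsol.weak_aux hF hP hΩ (hψ.add hχ) (hs.add hχs) ht).2 hni'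
    rw [integral_add (integrable_of_continuous_fst hψ.continuous hs)
      (integrable_of_continuous_fst hχ.continuous hχs), h0, zero_add] at this
    exact hR.ne' this
  refine hni ((h2.sub h1).congr fun s hs' => ?_)
  rw [uIoc_of_le ht] at hs'
  have hPs := hP s hs'.1.le
  have e : ∀ z : ℝ × ℝ, F (μ s) z * deriv (fun x => ψ x + cutoff R x) z.1 =
      F (μ s) z * deriv ψ z.1 + F (μ s) z * deriv (cutoff R) z.1 := fun z => by
    rw [deriv_fun_add (hψ.differentiable (by norm_num) _) (hχ.differentiable (by norm_num) _),
      mul_add]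
  simp only [e]
  rw [integral_add (hF.integrable_mul hΩ hPs hPs (hψ.continuous_deriv le_rfl) hs.deriv)
    (hF.integrable_mul hΩ hPs hPs (hχ.continuous_deriv le_rfl) hχs.deriv)]
  simp

end

section

/-- `H` is an indefinite integral of `p` on `[a, b]`. -/
def IsPrimOn (H p : ℝ → ℝ) (a b : ℝ) : Prop :=
  IntervalIntegrable p volume a b ∧ ∀ t ∈ Icc a b, H t = H a + ∫ s in a..t, p s

namespace IsPrimOn

variable {H p : ℝ → ℝ} {a b : ℝ}

lemma intervalIntegrable_sub (h : IsPrimOn H p a b) {a' b' : ℝ} (ha : a ≤ a') (hab : a' ≤ b')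
    (hb : b' ≤ b) : IntervalIntegrable p volume a' b' :=
  h.1.mono_set (by
    rw [uIcc_of_le hab, uIcc_of_le (ha.trans (hab.trans hb))]
    exact Icc_subset_Icc ha hb)

lemma mono (h : IsPrimOn H p a b) {a' b' : ℝ} (ha : a ≤ a') (hab : a' ≤ b')
    (hb : b' ≤ b) : IsPrimOn H p a' b' := by
  refine ⟨h.intervalIntegrable_sub ha hab hb, fun t ht => ?_⟩
  rw [h.2 t ⟨ha.trans ht.1, ht.2.trans hb⟩, h.2 a' ⟨ha, hab.trans hb⟩, add_assoc,
    intervalIntegral.integral_add_adjacent_intervals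
      (h.intervalIntegrable_sub le_rfl ha (hab.trans hb))
      (h.intervalIntegrable_sub ha ht.1 (ht.2.trans hb))]

lemma chain_rule (h : IsPrimOn H p a b) (hab : a ≤ b) {Φ φ' : ℝ → ℝ} {S : Set ℝ} {K : NNReal}
    (hS : ∀ t ∈ Icc a b, H t ∈ S) (hΦ : LipschitzOnWith K Φ S)
    (hd : ∀ t ∈ Icc a b, HasDerivAt Φ (φ' t) (H t)) :
    IsPrimOn (fun t => Φ (H t)) (fun t => φ' t * p t) a b := by
  refine ⟨(integral_chain_rule hab h.1 h.2 hS hΦ hd).1, fun t ht => ?_⟩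
  have h' := h.mono le_rfl ht.1 ht.2
  have := (integral_chain_rule ht.1 h'.1 h'.2 (fun s hs => hS s ⟨hs.1, hs.2.trans ht.2⟩) hΦ
    (fun s hs => hd s ⟨hs.1, hs.2.trans ht.2⟩)).2
  linarith

lemma sub_eq (h : IsPrimOn H p a b) (hab : a ≤ b) : H b - H a = ∫ s in a..b, p s := by
  rw [h.2 b ⟨hab, le_rfl⟩]; ring

lemma add (h : IsPrimOn H p a b) {H' p' : ℝ → ℝ} (h' : IsPrimOn H' p' a b) :
    IsPrimOn (fun t => H t + H' t) (fun t => p t + p' t) a b := by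
  refine ⟨h.1.add h'.1, fun t ht => ?_⟩
  have hab := ht.1.trans ht.2
  simp only
  rw [intervalIntegral.integral_add (h.mono le_rfl ht.1 ht.2).1 (h'.mono le_rfl ht.1 ht.2).1,
    h.2 t ht, h'.2 t ht]
  ring

lemma const_mul (h : IsPrimOn H p a b) (k : ℝ) :
    IsPrimOn (fun t => k * H t) (fun t => k * p t) a b := by
  refine ⟨h.1.const_mul k, fun t ht => ?_⟩
  simp only
  rw [intervalIntegral.integral_const_mul, h.2 t ht]
  ring

lemma sub (h : IsPrimOn H p a b) {H' p' : ℝ → ℝ} (h' : IsPrimOn H' p' a b) :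
    IsPrimOn (fun t => H t - H' t) (fun t => p t - p' t) a b := by
  refine ⟨h.1.sub h'.1, fun t ht => ?_⟩
  simp only
  rw [intervalIntegral.integral_sub (h.mono le_rfl ht.1 ht.2).1 (h'.mono le_rfl ht.1 ht.2).1,
    h.2 t ht, h'.2 t ht]
  ring

lemma congr (h : IsPrimOn H p a b) (hab : a ≤ b) {H' p' : ℝ → ℝ}
    (hH : ∀ t ∈ Icc a b, H t = H' t) (hp : ∀ t ∈ Icc a b, p t = p' t) : IsPrimOn H' p' a b := by
  refine ⟨h.1.congr fun t ht => ?_, fun t ht => ?_⟩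
  · rw [uIoc_of_le hab] at ht
    exact hp t ⟨ht.1.le, ht.2⟩
  · rw [← hH t ht, ← hH a ⟨le_rfl, hab⟩, h.2 t ht]
    congr 1
    refine intervalIntegral.integral_congr fun s hs => ?_
    rw [uIcc_of_le ht.1] at hs
    exact hp s ⟨hs.1, hs.2.trans ht.2⟩

/-- Two-sided Grönwall estimate, in multiplicative form. -/
lemma gronwall (h : IsPrimOn H p a b) (hab : a ≤ b) {g : ℝ → ℝ}
    (hg : IntervalIntegrable g volume a b) (hH : ∀ t ∈ Icc a b, 0 ≤ H t)
    (hpg : ∀ t ∈ Icc a b, |p t| ≤ g t * H t) (hg0 : ∀ t ∈ Icc a b, 0 ≤ g t)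
    {ε : ℝ} (hε : 0 < ε) :
    |Real.log (H b + ε) - Real.log (H a + ε)| ≤ ∫ s in a..b, g s := by
  have hL : LipschitzOnWith (Real.toNNReal ε⁻¹) (fun y => Real.log (y + ε)) (Ici 0) := by
    refine (convex_Ici 0).lipschitzOnWith_of_nnnorm_hasDerivWithin_le
      (f' := fun y => (y + ε)⁻¹) (fun y hy => ?_) (fun y hy => ?_)
    · have hy' : (0 : ℝ) ≤ y := hy
      have := ((hasDerivAt_id' y).add_const ε).log (by positivity)
      simpa using this.hasDerivWithinAt
    · have hy' : (0 : ℝ) ≤ y := hy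
      rw [← NNReal.coe_le_coe, coe_nnnorm, Real.coe_toNNReal _ (by positivity),
        Real.norm_eq_abs, abs_of_nonneg (by positivity)]
      exact inv_anti₀ hε (by linarith)
  have hc := h.chain_rule hab (S := Ici 0) hH hL (φ' := fun t => (H t + ε)⁻¹) (fun t ht => by
    have := hH t ht
    have := ((hasDerivAt_id' (H t)).add_const ε).log (by positivity)
    simpa using this)
  rw [hc.sub_eq hab, ← Real.norm_eq_abs]
  refine intervalIntegral.norm_integral_le_of_norm_le hab (Eventually.of_forall fun t ht => ?_) hg
  have htI : t ∈ Icc a b := ⟨ht.1.le, ht.2⟩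
  have h0 := hH t htI
  have h1 := hg0 t htI
  rw [norm_mul, Real.norm_eq_abs, Real.norm_eq_abs, abs_of_nonneg (by positivity : 0 ≤ (H t + ε)⁻¹),
    inv_mul_le_iff₀ (by positivity)]
  refine (hpg t htI).trans ?_
  nlinarith

end IsPrimOn

variable {ν : Measure ℝ} {F : Measure (ℝ × ℝ) → ℝ × ℝ → ℝ} {A B I M κ γ : ℝ}

lemma Framework.abs_sub_center_le [IsProbabilityMeasure ν] (hF : Framework ν F A B I M κ γ)
    (hΩ : Bornology.IsBounded (msupp ν))
    (hγ : γ = sSup {d : ℝ | ∃ ω ∈ msupp ν, ∃ ω' ∈ msupp ν, d = |ω - ω'|}) (hI : 0 < I)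
    {μ : Measure (ℝ × ℝ)} (hμ : μ ∈ P2nu ν) (x : ℝ) {ω : ℝ} (hω : ω ∈ msupp ν) :
    |F μ (x, ω) - F μ (0, wc ν)| ≤ κ * I * |x| + I * γ := by
  have h2 := hF.abs_sub_fst_le hμ x 0 ω
  have h3 := hF.abs_sub_snd_le hμ 0 ω (wc ν)
  have h6 : I * |ω - wc ν| ≤ I * γ := by gcongr; exact abs_sub_wc_le hΩ hγ hω
  have e : F μ (x, ω) - F μ (0, wc ν) =
    (F μ (x, ω) - F μ (0, ω)) + (F μ (0, ω) - F μ (0, wc ν)) := by ring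
  rw [e]
  refine (abs_add_le _ _).trans ?_
  rw [sub_zero] at h2
  linarith

lemma exists_test_deriv_pos (μ : Measure (ℝ × ℝ)) [IsProbabilityMeasure μ] :
    ∃ ψ : ℝ → ℝ, ContDiff ℝ 1 ψ ∧ HasCompactSupport ψ ∧ 1 / 2 < ∫ z, deriv ψ z.1 ∂μ := by
  have hχ : ContDiff ℝ 1 (cutoff 0 : ℝ → ℝ) := (cutoff 0).contDiff
  set ψ : ℝ → ℝ := fun x => x * cutoff 0 x with hψ
  have hψc : ContDiff ℝ 1 ψ := by fun_prop
  have hψs : HasCompactSupport ψ := (cutoff 0).hasCompactSupport.mul_left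
  have hd : Continuous (deriv ψ) := hψc.continuous_deriv le_rfl
  have hd0 : deriv ψ 0 = 1 := by
    have h2 : HasDerivAt (cutoff 0) (deriv (cutoff 0) 0) (0 : ℝ) :=
      ((hχ.differentiable (by norm_num)) 0).hasDerivAt
    rw [hψ, ((hasDerivAt_id' 0).fun_mul h2).deriv, cutoff_eq_one (by norm_num)]
    simp
  obtain ⟨C, hC⟩ := hψs.deriv.exists_bound_of_continuous hd
  have ht : Tendsto (fun n : ℕ => ∫ z, deriv ψ (z.1 / (n + 1 : ℝ)) ∂μ) atTop
      (nhds (∫ _, (1 : ℝ) ∂μ)) := by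
    refine tendsto_integral_of_dominated_convergence (fun _ => C) (fun n => ?_)
      (integrable_const C) (fun n => Eventually.of_forall fun z => hC _)
      (Eventually.of_forall fun z => ?_)
    · exact (hd.comp (by fun_prop : Continuous fun z : ℝ × ℝ => z.1 / (n + 1 : ℝ))).aestronglyMeasurable
    · rw [← hd0]
      refine (hd.tendsto 0).comp ?_
      exact tendsto_const_nhds.div_atTop (tendsto_natCast_atTop_atTop.atTop_add tendsto_const_nhds)
  rw [integral_const, probReal_univ, one_smul] at ht
  obtain ⟨n, hn⟩ := (ht.eventually (lt_mem_nhds (by norm_num : (1 / 2 : ℝ) < 1))).exists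
  have hn0 : (0 : ℝ) < n + 1 := by positivity
  refine ⟨fun x => (n + 1 : ℝ) * ψ (x / (n + 1 : ℝ)), ?_, ?_, ?_⟩
  · exact contDiff_const.mul (hψc.comp (by fun_prop))
  · refine HasCompactSupport.mul_left ?_
    have := hψs.comp_homeomorph (Homeomorph.mulRight₀ (n + 1 : ℝ)⁻¹ (by positivity))
    simpa [Function.comp_def, div_eq_mul_inv] using this
  · refine hn.trans_eq (integral_congr_ae (Eventually.of_forall fun z => ?_))
    have h1 : HasDerivAt ψ (deriv ψ (z.1 / (n + 1))) (z.1 / (n + 1 : ℝ)) :=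
      ((hψc.differentiable (by norm_num)) _).hasDerivAt
    have h2 := (h1.comp z.1 ((hasDerivAt_id' z.1).div_const (n + 1 : ℝ))).const_mul (n + 1 : ℝ)
    refine Eq.symm (h2.deriv.trans ?_)
    field_simp

/-- A time-integrable bound for the linear growth of the velocity field along a solution. -/
lemma IsSol.exists_growth [IsProbabilityMeasure ν] {μ : ℝ → Measure (ℝ × ℝ)} (hsol : IsSol F μ)
    (hF : Framework ν F A B I M κ γ)
    (hP : ∀ t : ℝ, 0 ≤ t → μ t ∈ P2nu ν) (hΩ : Bornology.IsBounded (msupp ν))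
    (hγ : γ = sSup {d : ℝ | ∃ ω ∈ msupp ν, ∃ ω' ∈ msupp ν, d = |ω - ω'|}) (hI : 0 < I)
    (hκ : 0 < κ) (hγ0 : 0 < γ) {T : ℝ} (hT : 0 ≤ T) :
    ∃ c : ℝ → ℝ, IntervalIntegrable c volume 0 T ∧ (∀ s, 0 ≤ c s) ∧
      ∀ s ∈ Icc 0 T, ∀ x, ∀ ω ∈ msupp ν, |F (μ s) (x, ω)| ≤ c s * (1 + |x|) := by
  suffices h : ∃ c : ℝ → ℝ, IntervalIntegrable c volume 0 T ∧ (∀ s, 0 ≤ c s) ∧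
      ∀ s ∈ Icc 0 T, s ∈ Icc 0 T → ∀ x, ∀ ω ∈ msupp ν, |F (μ s) (x, ω)| ≤ c s * (1 + |x|) by
    obtain ⟨c, h1, h2, h3⟩ := h
    exact ⟨c, h1, h2, fun s hs => h3 s hs hs⟩
  refine isCompact_Icc.induction_on (p := fun S => ∃ c : ℝ → ℝ, IntervalIntegrable c volume 0 T ∧
    (∀ s, 0 ≤ c s) ∧ ∀ s ∈ S, s ∈ Icc 0 T → ∀ x, ∀ ω ∈ msupp ν,
      |F (μ s) (x, ω)| ≤ c s * (1 + |x|)) ?_ ?_ ?_ ?_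
  · exact ⟨0, IntervalIntegrable.zero, fun s => le_rfl, fun s hs => absurd hs (notMem_empty s)⟩
  · rintro s t hst ⟨c, h1, h2, h3⟩
    exact ⟨c, h1, h2, fun r hr => h3 r (hst hr)⟩
  · rintro s t ⟨c, h1, h2, h3⟩ ⟨c', h1', h2', h3'⟩
    refine ⟨fun r => c r + c' r, h1.add h1', fun r => add_nonneg (h2 r) (h2' r), ?_⟩
    rintro r (hr | hr) hrT x ω hω
    · refine (h3 r hr hrT x ω hω).trans ?_
      have := h2' r
      gcongr; linarith
    · refine (h3' r hr hrT x ω hω).trans ?_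
      have := h2 r
      gcongr; linarith
  · intro s0 hs0
    have := (hP s0 hs0.1).1
    obtain ⟨ψ, hψ, hψs, hpos⟩ := exists_test_deriv_pos (μ s0)
    have hd : Continuous (deriv ψ) := hψ.continuous_deriv le_rfl
    have hev := ((hsol.continuousOn_integral hP hΩ hd hψs.deriv) s0 hs0.1).eventually
      (lt_mem_nhds hpos)
    obtain ⟨K, hK⟩ := hψs.deriv.exists_bound_of_continuous hd
    obtain ⟨r, hr⟩ := hψs.deriv.isCompact.isBounded.exists_norm_le
    have hr' : ∀ x, deriv ψ x ≠ 0 → |x| ≤ r := fun x hx => hr x (subset_tsupport _ hx)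
    have hK0 : 0 ≤ K := (norm_nonneg _).trans (hK 0)
    set C := (κ * I * |r| + I * γ) * K with hC
    have hC0 : 0 ≤ C := by positivity
    refine ⟨{s | 1 / 2 < ∫ z, deriv ψ z.1 ∂(μ s)} ∩ Icc 0 T, ?_,
      fun s => 2 * |∫ z, F (μ s) z * deriv ψ z.1 ∂(μ s)| + (2 * C + κ * I + I * γ), ?_, ?_, ?_⟩
    · exact inter_mem (nhdsWithin_mono _ (fun s hs => hs.1) hev) self_mem_nhdsWithin
    · exact ((hsol.weak hF hP hΩ hψ hψs hT).1.abs.const_mul 2).add intervalIntegrable_const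
    · intro s; positivity
    · rintro s ⟨hs, -⟩ hsT x ω hω
      have hPs := hP s hsT.1
      have := hPs.1
      set β := F (μ s) (0, wc ν)
      set f := ∫ z, F (μ s) z * deriv ψ z.1 ∂(μ s)
      set k := ∫ z, deriv ψ z.1 ∂(μ s)
      have hk : 1 / 2 < k := hs
      have hfk : |f - β * k| ≤ C := by
        have e : f - β * k = ∫ z, (F (μ s) z - β) * deriv ψ z.1 ∂(μ s) := by
          simp only [sub_mul]
          rw [integral_sub (hF.integrable_mul hΩ hPs hPs hd hψs.deriv)
            ((integrable_of_continuous_fst hd hψs.deriv).const_mul _), integral_const_mul]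
        rw [e, ← Real.norm_eq_abs]
        have := norm_integral_le_of_norm_le_const (μ := μ s)
          (f := fun z => (F (μ s) z - β) * deriv ψ z.1) (C := C) ?_
        · simpa using this
        filter_upwards [ae_snd_mem_msupp hPs] with z hz
        rw [norm_mul]
        by_cases h0 : deriv ψ z.1 = 0
        · rw [h0, norm_zero, mul_zero]; exact hC0
        · refine mul_le_mul ?_ (hK _) (norm_nonneg _) (by positivity)
          refine (hF.abs_sub_center_le hΩ hγ hI hPs z.1 hz).trans ?_
          have := (hr' _ h0).trans (le_abs_self r)
          gcongr
      have hβ : |β| ≤ 2 * |f| + 2 * C := by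
        have h1 : |β| * k ≤ |f| + C := by
          rw [← abs_of_pos (by linarith : 0 < k), ← abs_mul]
          have := abs_sub_abs_le_abs_sub (β * k) f
          rw [abs_sub_comm] at this
          linarith
        nlinarith [abs_nonneg β]
      have h2 := hF.abs_sub_center_le hΩ hγ hI hPs x hω
      have h3 := abs_sub_abs_le_abs_sub (F (μ s) (x, ω)) β
      have h4 := abs_nonneg x
      have h5 : 0 ≤ κ * I := by positivity
      have h6 : 0 ≤ I * γ := by positivity
      have h7 := abs_nonneg f
      have h8 : |F (μ s) (x, ω)| ≤ 2 * |f| + 2 * C + κ * I * |x| + I * γ := by linarith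
      refine h8.trans ?_
      nlinarith [mul_nonneg h7 h4, mul_nonneg hC0 h4, mul_nonneg h6 h4]

end

/-- A measure-valued solution together with the standing assumptions. -/
structure SolCtx (ν : Measure ℝ) (F : Measure (ℝ × ℝ) → ℝ × ℝ → ℝ) (A B I M κ γ : ℝ)
    (μ : ℝ → Measure (ℝ × ℝ)) : Prop where
  isProb : IsProbabilityMeasure ν
  bdd : Bornology.IsBounded (msupp ν)
  gamma_eq : γ = sSup {d : ℝ | ∃ ω ∈ msupp ν, ∃ ω' ∈ msupp ν, d = |ω - ω'|}
  A_pos : 0 < A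
  I_pos : 0 < I
  M_pos : 0 < M
  kappa_pos : 0 < κ
  gamma_pos : 0 < γ
  fw : Framework ν F A B I M κ γ
  sol : IsSol F μ
  mem : ∀ t : ℝ, 0 ≤ t → μ t ∈ P2nu ν

/-- The derivative of `t ↦ ∫ ψ(x) dμ_t` predicted by the equation. -/
def rate (F : Measure (ℝ × ℝ) → ℝ × ℝ → ℝ) (μ : ℝ → Measure (ℝ × ℝ)) (ψ : ℝ → ℝ) (s : ℝ) : ℝ :=
  ∫ z, F (μ s) z * deriv ψ z.1 ∂(μ s)

namespace SolCtx

variable {ν : Measure ℝ} {F : Measure (ℝ × ℝ) → ℝ × ℝ → ℝ} {A B I M κ γ : ℝ}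
  {μ : ℝ → Measure (ℝ × ℝ)}

lemma weak (S : SolCtx ν F A B I M κ γ μ) {ψ : ℝ → ℝ} (hψ : ContDiff ℝ 1 ψ)
    (hs : HasCompactSupport ψ) {T : ℝ} (hT : 0 ≤ T) :
    IsPrimOn (fun t => ∫ z, ψ z.1 ∂(μ t)) (rate F μ ψ) 0 T :=
  ⟨(S.sol.weak S.fw S.mem S.bdd hψ hs hT).1,
    fun _ ht => (S.sol.weak S.fw S.mem S.bdd hψ hs ht.1).2⟩

lemma ae_snd (S : SolCtx ν F A B I M κ γ μ) {t : ℝ} (ht : 0 ≤ t) :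
    ∀ᵐ z ∂(μ t), z.2 ∈ msupp ν := ae_snd_mem_msupp (S.mem t ht)

lemma exists_growth (S : SolCtx ν F A B I M κ γ μ) {T : ℝ} (hT : 0 ≤ T) :
    ∃ c : ℝ → ℝ, IntervalIntegrable c volume 0 T ∧ (∀ s, 0 ≤ c s) ∧
      ∀ s ∈ Icc 0 T, ∀ x, ∀ ω ∈ msupp ν, |F (μ s) (x, ω)| ≤ c s * (1 + |x|) := by
  have := S.isProb
  exact S.sol.exists_growth S.fw S.mem S.bdd S.gamma_eq S.I_pos S.kappa_pos S.gamma_pos hT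

lemma norm_mul_le_of_growth (S : SolCtx ν F A B I M κ γ μ) {T : ℝ} {c : ℝ → ℝ}
    (hc0 : ∀ s, 0 ≤ c s)
    (hc : ∀ s ∈ Icc 0 T, ∀ x, ∀ ω ∈ msupp ν, |F (μ s) (x, ω)| ≤ c s * (1 + |x|)) {s : ℝ}
    (hs : s ∈ Icc 0 T) {φ K : ℝ → ℝ} (hφ : ∀ x, (1 + |x|) * |φ x| ≤ K x) :
    ∀ᵐ z ∂(μ s), ‖F (μ s) z * φ z.1‖ ≤ c s * K z.1 := by
  filter_upwards [S.ae_snd hs.1] with z hz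
  rw [norm_mul, Real.norm_eq_abs, Real.norm_eq_abs]
  calc |F (μ s) z| * |φ z.1| ≤ c s * (1 + |z.1|) * |φ z.1| := by
        gcongr; exact hc s hs z.1 z.2 hz
    _ = c s * ((1 + |z.1|) * |φ z.1|) := by ring
    _ ≤ c s * K z.1 := mul_le_mul_of_nonneg_left (hφ _) (hc0 s)

/-- The weak formulation for bounded `C¹` functions of `x` whose derivative decays like `1/|x|`. -/
lemma weak_bounded (S : SolCtx ν F A B I M κ γ μ) {ψ : ℝ → ℝ} (hψ : ContDiff ℝ 1 ψ) {K : ℝ}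
    (hK : ∀ x, |ψ x| ≤ K) (hK' : ∀ x, (1 + |x|) * |deriv ψ x| ≤ K) {T : ℝ} (hT : 0 ≤ T) :
    IsPrimOn (fun t => ∫ z, ψ z.1 ∂(μ t)) (rate F μ ψ) 0 T := by
  obtain ⟨c, hcI, hc0, hc⟩ := S.exists_growth hT
  have hχ : ContDiff ℝ 1 (cutoff 1 : ℝ → ℝ) := (cutoff 1).contDiff
  have hχd : Continuous (deriv (cutoff 1)) := hχ.continuous_deriv le_rfl
  have hχs := (cutoff 1).hasCompactSupport
  obtain ⟨Q, hQ⟩ := (HasCompactSupport.mul_left (f := fun y : ℝ => 1 + |y|)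
    hχs.deriv).exists_bound_of_continuous (by fun_prop)
  have hQ' : ∀ y, (1 + |y|) * |deriv (cutoff 1) y| ≤ Q := fun y => by
    have := hQ y
    rwa [Pi.mul_apply, norm_mul, Real.norm_eq_abs, Real.norm_eq_abs,
      abs_of_nonneg (by positivity)] at this
  have hK0 : 0 ≤ K := (abs_nonneg _).trans (hK 0)
  set ψn : ℕ → ℝ → ℝ := fun n x => ψ x * cutoff 1 (x / (n + 1 : ℝ)) with hψn
  have hψnc : ∀ n, ContDiff ℝ 1 (ψn n) := fun n => hψ.mul (hχ.comp (by fun_prop))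
  have hψns : ∀ n, HasCompactSupport (ψn n) := fun n => by
    refine HasCompactSupport.mul_left ?_
    have := hχs.comp_homeomorph (Homeomorph.mulRight₀ (n + 1 : ℝ)⁻¹ (by positivity))
    simpa [Function.comp_def, div_eq_mul_inv] using this
  have hder : ∀ n x, deriv (ψn n) x = deriv ψ x * cutoff 1 (x / (n + 1 : ℝ)) +
      ψ x * (deriv (cutoff 1) (x / (n + 1 : ℝ)) * (1 / (n + 1 : ℝ))) := fun n x => by
    have h1 : HasDerivAt (cutoff 1) (deriv (cutoff 1) (x / (n + 1))) (x / (n + 1 : ℝ)) :=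
      ((hχ.differentiable (by norm_num)) _).hasDerivAt
    have h2 := h1.comp x ((hasDerivAt_id' x).div_const (n + 1 : ℝ))
    have h3 : HasDerivAt ψ (deriv ψ x) x := ((hψ.differentiable (by norm_num)) _).hasDerivAt
    exact (h3.fun_mul h2).deriv
  have hχ1 : ∀ y, |cutoff 1 y| ≤ 1 := fun y => by
    rw [abs_of_nonneg (cutoff 1).nonneg]; exact (cutoff 1).le_one
  have hn1 : ∀ n : ℕ, (1 : ℝ) ≤ n + 1 := fun n => by simp
  have hbound : ∀ n x, (1 + |x|) * |deriv (ψn n) x| ≤ K + K * Q := fun n x => by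
    rw [hder]
    have hm := hn1 n
    set m : ℝ := n + 1
    have h1 : (1 + |x|) * |deriv ψ x * cutoff 1 (x / m)| ≤ K := by
      rw [abs_mul, ← mul_assoc]
      calc _ ≤ (1 + |x|) * |deriv ψ x| * 1 := by gcongr; exact hχ1 _
        _ ≤ K := by rw [mul_one]; exact hK' x
    have h2 : (1 + |x|) * |ψ x * (deriv (cutoff 1) (x / m) * (1 / m))| ≤ K * Q := by
      rw [abs_mul, abs_mul, abs_of_nonneg (by positivity : 0 ≤ 1 / m)]
      have h3 : (1 + |x|) * (1 / m) ≤ 1 + |x / m| := by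
        rw [abs_div, abs_of_pos (by linarith : 0 < m), add_mul, one_mul, mul_one_div]
        gcongr
        rw [div_le_one (by linarith)]; exact hm
      calc _ = |ψ x| * (((1 + |x|) * (1 / m)) * |deriv (cutoff 1) (x / m)|) := by ring
        _ ≤ K * ((1 + |x / m|) * |deriv (cutoff 1) (x / m)|) := by gcongr; exact hK x
        _ ≤ K * Q := by gcongr; exact hQ' _
    calc _ ≤ (1 + |x|) * (|deriv ψ x * cutoff 1 (x / m)| +
          |ψ x * (deriv (cutoff 1) (x / m) * (1 / m))|) := by gcongr; exact abs_add_le _ _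
      _ ≤ K + K * Q := by rw [mul_add]; exact add_le_add h1 h2
  have hev : ∀ x : ℝ, ∀ᶠ n : ℕ in atTop, |x / (n + 1 : ℝ)| ≤ 1 := fun x => by
    filter_upwards [eventually_ge_atTop ⌈|x|⌉₊] with n hn
    have h1 : |x| ≤ n := (Nat.le_ceil _).trans (by exact_mod_cast hn)
    rw [abs_div, abs_of_pos (by positivity : (0 : ℝ) < n + 1), div_le_one (by positivity)]
    linarith
  have hlim1 : ∀ t, 0 ≤ t → Tendsto (fun n => ∫ z, ψn n z.1 ∂(μ t)) atTop
      (nhds (∫ z, ψ z.1 ∂(μ t))) := fun t ht => by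
    have := (S.mem t ht).1
    refine tendsto_integral_of_dominated_convergence (fun _ => K) (fun n => ?_)
      (integrable_const K) (fun n => Eventually.of_forall fun z => ?_)
      (Eventually.of_forall fun z => ?_)
    · exact ((hψnc n).continuous.comp continuous_fst).aestronglyMeasurable
    · rw [hψn, norm_mul]
      calc _ ≤ K * 1 := mul_le_mul (hK _) (hχ1 _) (abs_nonneg _) hK0
        _ = K := mul_one K
    · refine tendsto_const_nhds.congr' ?_
      filter_upwards [hev z.1] with n hn
      simp only [hψn]
      rw [cutoff_eq_one (by linarith), mul_one]
  have hlim2 : ∀ s ∈ Icc 0 T, Tendsto (fun n => rate F μ (ψn n) s) atTop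
      (nhds (rate F μ ψ s)) := fun s hs => by
    have := (S.mem s hs.1).1
    refine tendsto_integral_of_dominated_convergence (fun _ => c s * (K + K * Q)) (fun n => ?_)
      (integrable_const _)
      (fun n => S.norm_mul_le_of_growth hc0 hc hs (K := fun _ => K + K * Q) (hbound n))
      (Eventually.of_forall fun z => ?_)
    · have h1 := (hψnc n).continuous_deriv le_rfl
      exact ((S.fw.continuous (S.mem s hs.1)).mul (h1.comp continuous_fst)).aestronglyMeasurable
    · refine tendsto_const_nhds.congr' ?_
      filter_upwards [hev z.1] with n hn
      rw [hder, cutoff_eq_one (by linarith), deriv_cutoff_eq_zero hn]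
      ring
  have hnorm : ∀ n, ∀ s ∈ Icc 0 T, ‖rate F μ (ψn n) s‖ ≤ c s * (K + K * Q) := fun n s hs => by
    have := (S.mem s hs.1).1
    have := norm_integral_le_of_norm_le_const
      (S.norm_mul_le_of_growth hc0 hc hs (K := fun _ => K + K * Q) (hbound n))
    simpa [rate] using this
  have hII : IntervalIntegrable (rate F μ ψ) volume 0 T := by
    have hb : IntervalIntegrable (fun s => c s * (K + K * Q)) volume 0 T := hcI.mul_const _
    have hmem : ∀ᵐ s ∂(volume.restrict (uIoc 0 T)), s ∈ Icc 0 T := by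
      filter_upwards [ae_restrict_mem measurableSet_uIoc] with s hs
      rw [uIoc_of_le hT] at hs
      exact ⟨hs.1.le, hs.2⟩
    refine hb.mono_fun' (aestronglyMeasurable_of_tendsto_ae atTop
      (f := fun n => rate F μ (ψn n)) (fun n => ?_) ?_) ?_
    · exact ((S.weak (hψnc n) (hψns n) hT).1.def').aestronglyMeasurable
    · filter_upwards [hmem] with s hs using hlim2 s hs
    · filter_upwards [hmem] with s hs
      exact le_of_tendsto (hlim2 s hs).norm (Eventually.of_forall fun n => hnorm n s hs)
  refine ⟨hII, fun t ht => ?_⟩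
  have hsub : ∀ s ∈ uIoc 0 t, s ∈ Icc 0 T := fun s hs => by
    rw [uIoc_of_le ht.1] at hs
    exact ⟨hs.1.le, hs.2.trans ht.2⟩
  have hlim3 : Tendsto (fun n => ∫ s in (0 : ℝ)..t, rate F μ (ψn n) s) atTop
      (nhds (∫ s in (0 : ℝ)..t, rate F μ ψ s)) := by
    refine intervalIntegral.tendsto_integral_filter_of_dominated_convergence
      (fun s => c s * (K + K * Q)) (Eventually.of_forall fun n => ?_)
      (Eventually.of_forall fun n => Eventually.of_forall fun s hs => hnorm n s (hsub s hs))
      ((hcI.mono_set ?_).mul_const _)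
      (Eventually.of_forall fun s hs => hlim2 s (hsub s hs))
    · exact ((S.weak (hψnc n) (hψns n) ht.1).1.def').aestronglyMeasurable
    · rw [uIcc_of_le ht.1, uIcc_of_le hT]
      exact Icc_subset_Icc le_rfl ht.2
  refine tendsto_nhds_unique (hlim1 t ht.1) (((hlim1 0 le_rfl).add hlim3).congr fun n => ?_)
  exact ((S.weak (hψnc n) (hψns n) ht.1).2 t ⟨ht.1, le_rfl⟩).symm

end SolCtx

/-- A smooth transition between `x² < α - 1` and `x² > α - 1`, sharper for larger `k`. -/
def transition (α : ℝ) (k : ℕ) (x : ℝ) : ℝ :=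
  ((1 + x ^ 2) / α) ^ (k + 1) / (1 + ((1 + x ^ 2) / α) ^ (k + 1))

lemma transition_nonneg {α : ℝ} (hα : 0 < α) (k : ℕ) (x : ℝ) : 0 ≤ transition α k x := by
  unfold transition; positivity

lemma transition_le_one {α : ℝ} (hα : 0 < α) (k : ℕ) (x : ℝ) : transition α k x ≤ 1 := by
  unfold transition
  rw [div_le_one (by positivity)]
  linarith

lemma transition_le_pow {α : ℝ} (hα : 0 < α) (k : ℕ) (x : ℝ) :
    transition α k x ≤ ((1 + x ^ 2) / α) ^ (k + 1) :=
  div_le_self (by positivity) (by linarith [show 0 ≤ ((1 + x ^ 2) / α) ^ (k + 1) by positivity])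

lemma half_le_transition {α : ℝ} (hα : 0 < α) (k : ℕ) {x : ℝ} (h : α ≤ 1 + x ^ 2) :
    1 / 2 ≤ transition α k x := by
  unfold transition
  have h1 : 1 ≤ ((1 + x ^ 2) / α) ^ (k + 1) := one_le_pow₀ (by rwa [one_le_div hα])
  rw [div_le_div_iff₀ (by norm_num) (by positivity)]
  linarith

lemma contDiff_transition {α : ℝ} (hα : 0 < α) (k : ℕ) : ContDiff ℝ 1 (transition α k) := by
  unfold transition
  refine ContDiff.div (by fun_prop) (by fun_prop) fun x => ?_
  positivity

lemma abs_deriv_transition_le {α : ℝ} (hα : 0 < α) (k : ℕ) (x : ℝ) :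
    (1 + |x|) * |deriv (transition α k) x| ≤ 3 * (k + 1) * transition α k x := by
  set v := (1 + x ^ 2) / α with hv
  have hv0 : 0 < v := by positivity
  have h1 : HasDerivAt (fun x : ℝ => (1 + x ^ 2) / α) (2 * x / α) x := by
    have := (((hasDerivAt_id' x).fun_pow 2).const_add 1).div_const α
    simpa using this
  have h2 := h1.fun_pow (k + 1)
  have h3 := h2.fun_div (h2.const_add 1) (by positivity)
  have h4 : deriv (transition α k) x =
      ((k + 1) * v ^ k * (2 * x / α)) / (1 + v ^ (k + 1)) ^ 2 := by
    refine h3.deriv.trans ?_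
    rw [← hv]
    push_cast
    congr 1
    ring
  have h5 : (1 + |x|) * |2 * x / α| ≤ 3 * v := by
    rw [abs_div, abs_of_pos hα, hv, ← mul_div_assoc, ← mul_div_assoc, abs_mul, abs_two]
    refine div_le_div_of_nonneg_right ?_ hα.le
    nlinarith [sq_abs x, sq_nonneg (|x| - 1), abs_nonneg x]
  rw [h4, abs_div, abs_mul, abs_of_nonneg (by positivity : 0 ≤ ((k : ℝ) + 1) * v ^ k),
    abs_of_nonneg (by positivity : 0 ≤ (1 + v ^ (k + 1)) ^ 2)]
  have h6 : transition α k x = v ^ (k + 1) / (1 + v ^ (k + 1)) := rfl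
  rw [h6]
  calc _ = ((k : ℝ) + 1) * v ^ k * ((1 + |x|) * |2 * x / α|) / (1 + v ^ (k + 1)) ^ 2 := by ring
    _ ≤ ((k : ℝ) + 1) * v ^ k * (3 * v) / (1 + v ^ (k + 1)) ^ 2 := by gcongr
    _ = 3 * (k + 1) * (v ^ (k + 1) / (1 + v ^ (k + 1)) ^ 2) := by ring
    _ ≤ _ := by
        gcongr
        exact le_self_pow₀ (by linarith [show 0 ≤ v ^ (k + 1) by positivity]) (by norm_num)

namespace SolCtx

variable {ν : Measure ℝ} {F : Measure (ℝ × ℝ) → ℝ × ℝ → ℝ} {A B I M κ γ : ℝ}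
  {μ : ℝ → Measure (ℝ × ℝ)}

lemma log_transition_le (S : SolCtx ν F A B I M κ γ μ) {T : ℝ} (hT : 0 ≤ T) {c : ℝ → ℝ}
    (hcI : IntervalIntegrable c volume 0 T) (hc0 : ∀ s, 0 ≤ c s)
    (hc : ∀ s ∈ Icc 0 T, ∀ x, ∀ ω ∈ msupp ν, |F (μ s) (x, ω)| ≤ c s * (1 + |x|))
    {α : ℝ} (hα : 0 < α) (k : ℕ) {ε : ℝ} (hε : 0 < ε) {a b : ℝ} (ha : 0 ≤ a) (hab : a ≤ b)
    (hb : b ≤ T) :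
    |Real.log ((∫ z, transition α k z.1 ∂(μ b)) + ε) -
      Real.log ((∫ z, transition α k z.1 ∂(μ a)) + ε)| ≤ 3 * (k + 1) * ∫ s in (0 : ℝ)..T, c s := by
  have hprim := (S.weak_bounded (contDiff_transition hα k) (K := 3 * (k + 1)) (fun x => by
    rw [abs_of_nonneg (transition_nonneg hα k x)]
    refine (transition_le_one hα k x).trans ?_
    linarith [show (0 : ℝ) ≤ k by positivity]) (fun x => by
      refine (abs_deriv_transition_le hα k x).trans ?_
      exact mul_le_of_le_one_right (by positivity) (transition_le_one hα k x)) hT).mono ha hab hb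
  have hcI' : IntervalIntegrable c volume a b := hcI.mono_set (by
    rw [uIcc_of_le hab, uIcc_of_le hT]
    exact Icc_subset_Icc ha hb)
  refine (hprim.gronwall hab (g := fun s => 3 * (k + 1) * c s) (hcI'.const_mul _)
    (fun t _ => integral_nonneg fun z => transition_nonneg hα k z.1) (fun t ht => ?_)
    (fun t _ => mul_nonneg (by positivity) (hc0 t)) hε).trans ?_
  · have ht' : t ∈ Icc 0 T := ⟨ha.trans ht.1, ht.2.trans hb⟩
    have := (S.mem t ht'.1).1
    have hint : Integrable (fun z : ℝ × ℝ => transition α k z.1) (μ t) := by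
      refine Integrable.of_bound
        ((contDiff_transition hα k).continuous.comp continuous_fst).aestronglyMeasurable 1
        (Eventually.of_forall fun z => ?_)
      rw [Real.norm_eq_abs, abs_of_nonneg (transition_nonneg hα k _)]
      exact transition_le_one hα k _
    have h1 := norm_integral_le_of_norm_le (hint.const_mul (c t * (3 * (k + 1))))
      (f := fun z => F (μ t) z * deriv (transition α k) z.1) (by
        filter_upwards [S.norm_mul_le_of_growth hc0 hc ht' (abs_deriv_transition_le hα k)]
          with z hz
        refine hz.trans (le_of_eq ?_)
        ring)
    rw [integral_const_mul] at h1
    refine h1.trans (le_of_eq ?_)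
    ring
  · rw [intervalIntegral.integral_const_mul]
    refine mul_le_mul_of_nonneg_left ?_ (by positivity)
    exact intervalIntegral.integral_mono_interval ha hab hb
      (Eventually.of_forall hc0) hcI

/-- Boundedness of the support at one time implies uniform boundedness on compact time intervals,
forward and backward in time. -/
lemma exists_uniform_bound (S : SolCtx ν F A B I M κ γ μ) {T s L : ℝ} (hs : s ∈ Icc 0 T)
    (hL : XBdd (μ s) L) : ∃ L', ∀ t ∈ Icc 0 T, XBdd (μ t) L' := by
  have hT : 0 ≤ T := hs.1.trans hs.2
  obtain ⟨c, hcI, hc0, hc⟩ := S.exists_growth hT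
  set C := ∫ s in (0 : ℝ)..T, c s
  set q := Real.exp (-(3 * C)) / 2 with hq
  have hq0 : 0 < q := by positivity
  set α := (1 + L ^ 2) / q with hα
  have hα0 : 0 < α := by positivity
  refine ⟨α, fun t ht => ?_⟩
  have := (S.mem t ht.1).1
  have hHt0 : ∀ k, 0 ≤ ∫ z, transition α k z.1 ∂(μ t) := fun k =>
    integral_nonneg fun z => transition_nonneg hα0 k z.1
  have hHs0 : ∀ k, 0 ≤ ∫ z, transition α k z.1 ∂(μ s) := fun k =>
    integral_nonneg fun z => transition_nonneg hα0 k z.1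
  have hint : ∀ r, 0 ≤ r → ∀ k, Integrable (fun z : ℝ × ℝ => transition α k z.1) (μ r) := by
    intro r hr k
    have := (S.mem r hr).1
    refine Integrable.of_bound
      ((contDiff_transition hα0 k).continuous.comp continuous_fst).aestronglyMeasurable 1
      (Eventually.of_forall fun z => ?_)
    rw [Real.norm_eq_abs, abs_of_nonneg (transition_nonneg hα0 k _)]
    exact transition_le_one hα0 k _
  have hHs : ∀ k : ℕ, ∫ z, transition α k z.1 ∂(μ s) ≤ q ^ (k + 1) := fun k => by
    have := (S.mem s hs.1).1
    have h1 := integral_mono_ae (hint s hs.1 k) (integrable_const (q ^ (k + 1))) (by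
      filter_upwards [hL] with z hz
      refine (transition_le_pow hα0 k z.1).trans ?_
      gcongr
      rw [div_le_iff₀ hα0, hα, mul_div_cancel₀ _ hq0.ne', ← sq_abs z.1]
      gcongr)
    simpa using h1
  have hHt : ∀ k : ℕ, ∫ z, transition α k z.1 ∂(μ t) ≤ 2 * (1 / 2) ^ (k + 1) := fun k => by
    have hε : 0 < q ^ (k + 1) := by positivity
    have hlog : Real.log ((∫ z, transition α k z.1 ∂(μ t)) + q ^ (k + 1)) -
        Real.log ((∫ z, transition α k z.1 ∂(μ s)) + q ^ (k + 1)) ≤ 3 * (k + 1) * C := by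
      rcases le_total s t with hst | hst
      · exact (le_abs_self _).trans (S.log_transition_le hT hcI hc0 hc hα0 k hε hs.1 hst ht.2)
      · rw [← neg_sub]
        exact (neg_le_abs _).trans (S.log_transition_le hT hcI hc0 hc hα0 k hε ht.1 hst hs.2)
    have hpos1 : 0 < (∫ z, transition α k z.1 ∂(μ t)) + q ^ (k + 1) := by linarith [hHt0 k]
    have hpos2 : 0 < (∫ z, transition α k z.1 ∂(μ s)) + q ^ (k + 1) := by linarith [hHs0 k]
    rw [← Real.log_div hpos1.ne' hpos2.ne', Real.log_le_iff_le_exp (by positivity),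
      div_le_iff₀ hpos2] at hlog
    have he : Real.exp (3 * (k + 1) * C) * q ^ (k + 1) = (1 / 2) ^ (k + 1) := by
      have : Real.exp (3 * (k + 1) * C) = Real.exp (3 * C) ^ (k + 1) := by
        rw [← Real.exp_nat_mul]; congr 1; push_cast; ring
      rw [this, ← mul_pow, hq, ← mul_div_assoc, ← Real.exp_add]
      simp
    calc _ ≤ (∫ z, transition α k z.1 ∂(μ t)) + q ^ (k + 1) := by linarith
      _ ≤ _ := hlog
      _ ≤ Real.exp (3 * (k + 1) * C) * (q ^ (k + 1) + q ^ (k + 1)) := by gcongr; exact hHs k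
      _ = 2 * (Real.exp (3 * (k + 1) * C) * q ^ (k + 1)) := by ring
      _ = _ := by rw [he]
  have hE : (μ t).real {z : ℝ × ℝ | α ≤ 1 + z.1 ^ 2} = 0 := by
    refine le_antisymm ?_ measureReal_nonneg
    have hk : ∀ k : ℕ, (μ t).real {z : ℝ × ℝ | α ≤ 1 + z.1 ^ 2} ≤ 4 * (1 / 2) ^ (k + 1) := by
      intro k
      have h1 := mul_meas_ge_le_integral_of_nonneg
        (Eventually.of_forall fun z : ℝ × ℝ => transition_nonneg hα0 k z.1) (hint t ht.1 k) (1 / 2)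
      have h2 : (μ t).real {z : ℝ × ℝ | α ≤ 1 + z.1 ^ 2} ≤
          (μ t).real {z : ℝ × ℝ | 1 / 2 ≤ transition α k z.1} :=
        measureReal_mono fun z hz => half_le_transition hα0 k hz
      linarith [hHt k]
    have hlim : Tendsto (fun k : ℕ => (4 : ℝ) * (1 / 2) ^ (k + 1)) atTop (nhds (4 * 0)) :=
      ((tendsto_pow_atTop_nhds_zero_of_lt_one (by norm_num) (by norm_num)).comp
        (tendsto_add_atTop_nat 1)).const_mul 4
    rw [mul_zero] at hlim
    exact ge_of_tendsto' hlim hk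
  rw [measureReal_eq_zero_iff] at hE
  have hae : ∀ᵐ z ∂(μ t), z ∉ {z : ℝ × ℝ | α ≤ 1 + z.1 ^ 2} := measure_eq_zero_iff_ae_notMem.1 hE
  filter_upwards [hae] with z hz
  have hz' : 1 + z.1 ^ 2 < α := not_le.1 hz
  nlinarith [sq_abs z.1, sq_nonneg (|z.1| - 1)]

end SolCtx

/-- The exponential moment in the `x` variable. -/
def expMoment (μ : Measure (ℝ × ℝ)) (l : ℝ) : ℝ := ∫ z, Real.exp (l * z.1) ∂μ

/-- The exponentially tilted measure in the `x` variable. -/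
def tiltX (μ : Measure (ℝ × ℝ)) (l : ℝ) : Measure (ℝ × ℝ) := μ.tilted fun z => l * z.1

/-- A smooth approximation from below of the diameter of the support, as `l → ∞`. -/
def softDiam (μ : Measure (ℝ × ℝ)) (l : ℝ) : ℝ :=
  (Real.log (expMoment μ l) + Real.log (expMoment μ (-l))) / l

lemma integral_le_integral_add {X : Type*} [MeasurableSpace X] {ρ ρ' : Measure X}
    [IsProbabilityMeasure ρ] [IsProbabilityMeasure ρ'] {φ : X → ℝ} (hφ : Integrable φ ρ)
    (hφ' : Integrable φ ρ') {p : X → Prop} (hp : ∀ᵐ z ∂ρ, p z) (hp' : ∀ᵐ z ∂ρ', p z) {C : ℝ}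
    (h : ∀ z, p z → ∀ z', p z' → φ z ≤ φ z' + C) : ∫ z, φ z ∂ρ ≤ (∫ z, φ z ∂ρ') + C := by
  have h1 : ∀ z', p z' → ∫ z, φ z ∂ρ ≤ φ z' + C := fun z' hz' => by
    have := integral_mono_ae hφ (integrable_const (φ z' + C)) (by
      filter_upwards [hp] with z hz using h z hz z' hz')
    simpa using this
  have h2 := integral_mono_ae (integrable_const (∫ z, φ z ∂ρ)) (hφ'.add (integrable_const C)) (by
    filter_upwards [hp'] with z hz using h1 z hz)
  simpa [integral_add hφ' (integrable_const C)] using h2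

lemma ae_tiltX {μ : Measure (ℝ × ℝ)} {p : ℝ × ℝ → Prop} (hp : ∀ᵐ z ∂μ, p z) (l : ℝ) : ∀ᵐ z ∂(tiltX μ l), p z :=
  (tilted_absolutelyContinuous μ _).ae_le hp

lemma integral_tiltX (μ : Measure (ℝ × ℝ)) (φ : ℝ × ℝ → ℝ) (l : ℝ) :
    ∫ z, φ z ∂(tiltX μ l) = (expMoment μ l)⁻¹ * ∫ z, φ z * Real.exp (l * z.1) ∂μ := by
  unfold tiltX expMoment
  rw [integral_tilted, ← integral_const_mul]
  refine integral_congr_ae (Eventually.of_forall fun z => ?_)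
  simp only [smul_eq_mul]
  ring

lemma XBdd.tiltX_xBdd {μ : Measure (ℝ × ℝ)} {L : ℝ} (h : XBdd μ L) (l : ℝ) : XBdd (tiltX μ l) L := ae_tiltX h l

namespace XBdd

variable {μ : Measure (ℝ × ℝ)} [IsProbabilityMeasure μ] {L : ℝ}

lemma integrable_comp (h : XBdd μ L) {φ : ℝ → ℝ} (hφ : Continuous φ) :
    Integrable (fun z : ℝ × ℝ => φ z.1) μ := by
  obtain ⟨C, hC⟩ := (isCompact_Icc (a := -L) (b := L)).exists_bound_of_continuousOn hφ.continuousOn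
  refine Integrable.of_bound (by fun_prop) C ?_
  filter_upwards [h] with z hz using hC _ (abs_le.1 hz)

lemma integrable_exp (h : XBdd μ L) (l : ℝ) :
    Integrable (fun z : ℝ × ℝ => Real.exp (l * z.1)) μ :=
  h.integrable_comp (φ := fun x => Real.exp (l * x)) (by fun_prop)

lemma exp_le_expMoment (h : XBdd μ L) (l : ℝ) : Real.exp (-(|l| * L)) ≤ expMoment μ l := by
  have := integral_mono_ae (integrable_const (Real.exp (-(|l| * L)))) (h.integrable_exp l) (by
    filter_upwards [h] with z hz
    refine Real.exp_le_exp.2 ?_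
    have h1 : |l * z.1| ≤ |l| * L := by rw [abs_mul]; gcongr
    exact (abs_le.1 h1).1)
  simpa [expMoment] using this

lemma expMoment_pos (h : XBdd μ L) (l : ℝ) : 0 < expMoment μ l :=
  (Real.exp_pos _).trans_le (h.exp_le_expMoment l)

lemma isProbabilityMeasure_tiltX (h : XBdd μ L) (l : ℝ) : IsProbabilityMeasure (tiltX μ l) :=
  isProbabilityMeasure_tilted (h.integrable_exp l)

lemma log_expMoment_le (h : XBdd μ L) (l : ℝ) :
    Real.log (expMoment μ l) ≤ l * ∫ z, z.1 ∂(tiltX μ l) := by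
  have := h.isProbabilityMeasure_tiltX l
  have hP := h.expMoment_pos l
  have hx : Integrable (fun z : ℝ × ℝ => z.1) (tiltX μ l) :=
    (h.tiltX_xBdd l).integrable_comp continuous_id
  have he : Integrable (fun z : ℝ × ℝ => Real.exp (-(l * z.1))) (tiltX μ l) :=
    (h.tiltX_xBdd l).integrable_comp (φ := fun x => Real.exp (-(l * x))) (by fun_prop)
  have h1 : ∫ z : ℝ × ℝ, Real.exp (-(l * z.1)) ∂(tiltX μ l) = (expMoment μ l)⁻¹ := by
    rw [integral_tiltX]
    simp only [← Real.exp_add, neg_add_cancel, Real.exp_zero, integral_const, probReal_univ,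
      smul_eq_mul, mul_one]
  have h2 := integral_mono (μ := tiltX μ l)
    (f := fun z => 1 - expMoment μ l * Real.exp (-(l * z.1)))
    (g := fun z => l * z.1 - Real.log (expMoment μ l))
    ((integrable_const _).sub (he.const_mul _)) ((hx.const_mul l).sub (integrable_const _))
    (fun z => by
      have h3 := Real.add_one_le_exp (Real.log (expMoment μ l) - l * z.1)
      rw [sub_eq_add_neg, Real.exp_add, Real.exp_log hP] at h3
      simp only
      linarith)
  rw [integral_sub (integrable_const _) (he.const_mul _),
    integral_sub (hx.const_mul l) (integrable_const _), integral_const_mul, integral_const_mul,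
    h1, mul_inv_cancel₀ hP.ne'] at h2
  simp only [integral_const, probReal_univ, smul_eq_mul, one_mul] at h2
  linarith

lemma softDiam_le (h : XBdd μ L) {l : ℝ} (hl : 0 < l) :
    softDiam μ l ≤ (∫ z, z.1 ∂(tiltX μ l)) - ∫ z, z.1 ∂(tiltX μ (-l)) := by
  unfold softDiam
  rw [div_le_iff₀ hl]
  linarith [h.log_expMoment_le l, h.log_expMoment_le (-l)]

lemma integral_tiltX_sub_le_diamx (h : XBdd μ L) (l l' : ℝ) :
    (∫ z, z.1 ∂(tiltX μ l)) - ∫ z, z.1 ∂(tiltX μ l') ≤ diamx μ := by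
  have := h.isProbabilityMeasure_tiltX l
  have := h.isProbabilityMeasure_tiltX l'
  rw [sub_le_iff_le_add']
  exact integral_le_integral_add ((h.tiltX_xBdd l).integrable_comp continuous_id)
    ((h.tiltX_xBdd l').integrable_comp continuous_id) (ae_tiltX (ae_mem_msupp μ) l)
    (ae_tiltX (ae_mem_msupp μ) l') fun z hz z' hz' => by
      simpa using sub_le_iff_le_add'.1 (sub_le_diamx h.bddAbove hz hz')

lemma softDiam_le_diamx (h : XBdd μ L) {l : ℝ} (hl : 0 < l) : softDiam μ l ≤ diamx μ :=
  (h.softDiam_le hl).trans (h.integral_tiltX_sub_le_diamx l (-l))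

lemma diamx_le_two_mul (h : XBdd μ L) : diamx μ ≤ 2 * L :=
  diamx_le fun z hz z' hz' => by
    have h1 := abs_le.1 (h.abs_le_of_mem_msupp hz)
    have h2 := abs_le.1 (h.abs_le_of_mem_msupp hz')
    linarith [h1.2, h2.1]

lemma neg_le_softDiam (h : XBdd μ L) {l : ℝ} (hl : 0 < l) : -(2 * L) ≤ softDiam μ l := by
  have h1 : ∀ k, -(|k| * L) ≤ Real.log (expMoment μ k) := fun k =>
    (Real.le_log_iff_exp_le (h.expMoment_pos k)).2 (h.exp_le_expMoment k)
  have h2 := h1 l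
  have h3 := h1 (-l)
  rw [abs_neg] at h3
  rw [abs_of_pos hl] at h2 h3
  unfold softDiam
  rw [le_div_iff₀ hl]
  linarith

lemma exists_log_expMoment_ge (h : XBdd μ L) {z : ℝ × ℝ} (hz : z ∈ msupp μ) {ε : ℝ}
    (hε : 0 < ε) (σ : ℝ) (hσ : |σ| = 1) :
    ∃ C, ∀ l, 0 < l → l * (σ * z.1 - ε) + C ≤ Real.log (expMoment μ (l * σ)) := by
  set U : Set (ℝ × ℝ) := {w | |w.1 - z.1| < ε} with hU
  have hUo : IsOpen U := isOpen_lt (by fun_prop) continuous_const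
  have hm : 0 < μ.real U := by
    rw [measureReal_def]
    exact ENNReal.toReal_pos (hz U hUo (by simpa [hU] using hε)) (measure_ne_top _ _)
  refine ⟨Real.log (μ.real U), fun l hl => ?_⟩
  rw [Real.le_log_iff_exp_le (h.expMoment_pos _), Real.exp_add, Real.exp_log hm]
  have h1 := mul_meas_ge_le_integral_of_nonneg
    (Eventually.of_forall fun w : ℝ × ℝ => (Real.exp_pos (l * σ * w.1)).le)
    (h.integrable_exp (l * σ)) (Real.exp (l * (σ * z.1 - ε)))
  refine le_trans ?_ h1
  gcongr
  · exact measure_ne_top _ _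
  intro w hw
  have hw' : |w.1 - z.1| < ε := hw
  refine Real.exp_le_exp.2 ?_
  rw [mul_assoc]
  gcongr
  have h2 : |σ * (z.1 - w.1)| ≤ ε := by
    rw [abs_mul, hσ, one_mul, abs_sub_comm]; exact hw'.le
  linarith [(abs_le.1 h2).2]

lemma tendsto_softDiam (h : XBdd μ L) :
    Tendsto (fun n : ℕ => softDiam μ (n + 1)) atTop (nhds (diamx μ)) := by
  refine tendsto_order.2 ⟨fun d hd => ?_, fun d hd => Eventually.of_forall fun n =>
    (h.softDiam_le_diamx (by positivity)).trans_lt hd⟩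
  obtain ⟨z, hz, z', hz', hzz⟩ : ∃ z ∈ msupp μ, ∃ z' ∈ msupp μ, d < z.1 - z'.1 := by
    by_contra! hc
    exact absurd (diamx_le hc) (not_le.2 hd)
  set ε := (z.1 - z'.1 - d) / 4 with hε
  have hε0 : 0 < ε := by rw [hε]; linarith
  obtain ⟨C, hC⟩ := h.exists_log_expMoment_ge hz hε0 1 (by simp)
  obtain ⟨C', hC'⟩ := h.exists_log_expMoment_ge hz' hε0 (-1) (by simp)
  have hlim : Tendsto (fun n : ℕ => (z.1 - z'.1 - 2 * ε) + (C + C') / ((n : ℝ) + 1)) atTop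
      (nhds ((z.1 - z'.1 - 2 * ε) + 0)) :=
    tendsto_const_nhds.add (tendsto_const_nhds.div_atTop
      (tendsto_natCast_atTop_atTop.atTop_add tendsto_const_nhds))
  have hlt : d < (z.1 - z'.1 - 2 * ε) + 0 := by rw [hε]; linarith
  filter_upwards [hlim.eventually (lt_mem_nhds hlt)] with n hn
  refine hn.trans_le ?_
  have hn0 : (0 : ℝ) < (n : ℝ) + 1 := by positivity
  have h1 := hC _ hn0
  have h2 := hC' _ hn0
  rw [mul_one] at h1
  rw [mul_neg_one] at h2
  unfold softDiam
  rw [le_div_iff₀ hn0, add_mul, div_mul_cancel₀ _ hn0.ne']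
  linarith

end XBdd

lemma IsPrimOn.continuousOn {H p : ℝ → ℝ} {a b : ℝ} (h : IsPrimOn H p a b) :
    ContinuousOn H (Icc a b) := by
  by_cases hab : a ≤ b
  · have h1 : IntegrableOn p (uIcc a b) := by
      rw [uIcc_of_le hab, integrableOn_Icc_iff_integrableOn_Ioc]
      exact (intervalIntegrable_iff_integrableOn_Ioc_of_le hab).1 h.1
    have h2 := intervalIntegral.continuousOn_primitive_interval (f := p) (μ := volume) h1
    rw [uIcc_of_le hab] at h2
    exact (continuousOn_const.add h2).congr h.2
  · rw [Icc_eq_empty hab]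
    exact continuousOn_empty _

namespace SolCtx

variable {ν : Measure ℝ} {F : Measure (ℝ × ℝ) → ℝ × ℝ → ℝ} {A B I M κ γ : ℝ}
  {μ : ℝ → Measure (ℝ × ℝ)}

lemma weak_of_xBdd (S : SolCtx ν F A B I M κ γ μ) {T L : ℝ} (hT : 0 ≤ T)
    (hB : ∀ t ∈ Icc 0 T, XBdd (μ t) L) {ψ : ℝ → ℝ} (hψ : ContDiff ℝ 1 ψ) :
    IsPrimOn (fun t => ∫ z, ψ z.1 ∂(μ t)) (rate F μ ψ) 0 T := by
  have hχ : ContDiff ℝ 1 (cutoff L : ℝ → ℝ) := (cutoff L).contDiff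
  refine (S.weak (ψ := fun x => ψ x * cutoff L x) (hψ.mul hχ)
    ((cutoff L).hasCompactSupport.mul_left) hT).congr hT (fun t ht => ?_) (fun t ht => ?_)
  · refine integral_congr_ae ?_
    filter_upwards [hB t ht] with z hz
    rw [cutoff_eq_one (hz.trans (by linarith)), mul_one]
  · refine integral_congr_ae ?_
    filter_upwards [hB t ht] with z hz
    have h1 : HasDerivAt (cutoff L) (deriv (cutoff L) z.1) z.1 :=
      ((hχ.differentiable (by norm_num)) _).hasDerivAt
    have h3 : HasDerivAt ψ (deriv ψ z.1) z.1 := ((hψ.differentiable (by norm_num)) _).hasDerivAt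
    rw [(h3.fun_mul h1).deriv, cutoff_eq_one (hz.trans (by linarith)), deriv_cutoff_eq_zero hz]
    ring

lemma exists_velocity_bound (S : SolCtx ν F A B I M κ γ μ) {T L : ℝ}
    (hB : ∀ t ∈ Icc 0 T, XBdd (μ t) L) :
    ∃ C, 0 ≤ C ∧ ∀ s ∈ Icc 0 T, ∀ᵐ z ∂(μ s), |F (μ s) z| ≤ C := by
  have := S.isProb
  refine ⟨|κ * M * L + κ * I * L + I * γ| + |F (diracProd 0 ν) (0, wc ν)|, by positivity,
    fun s hs => ?_⟩
  have hW : W1 (μ s) (diracProd 0 ν) ≤ L := W1_diracProd_le_of_ae (S.mem s hs.1) (by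
    filter_upwards [hB s hs] with z hz; simpa using hz)
  filter_upwards [hB s hs, S.ae_snd hs.1] with z hz hz2
  have h1 := S.fw.abs_sub_diracProd_le S.bdd S.gamma_eq S.I_pos S.M_pos S.kappa_pos
    (S.mem s hs.1) hW (x := z.1) (ω := z.2) (by simpa using hz) hz2
  have h2 := abs_sub_abs_le_abs_sub (F (μ s) (z.1, z.2)) (F (diracProd 0 ν) (0, wc ν))
  have h3 := le_abs_self (κ * M * L + κ * I * L + I * γ)
  change |F (μ s) (z.1, z.2)| ≤ _
  linarith

lemma integrable_of_ae_bound (S : SolCtx ν F A B I M κ γ μ) {s C : ℝ} (hs : 0 ≤ s)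
    (hC : ∀ᵐ z ∂(μ s), |F (μ s) z| ≤ C) {ρ : Measure (ℝ × ℝ)} [IsProbabilityMeasure ρ]
    (hρ : ρ ≪ μ s) : Integrable (F (μ s)) ρ :=
  Integrable.of_bound (S.fw.continuous (S.mem s hs)).aestronglyMeasurable C (hρ.ae_le hC)

lemma xc_prim (S : SolCtx ν F A B I M κ γ μ) {T L : ℝ} (hT : 0 ≤ T)
    (hB : ∀ t ∈ Icc 0 T, XBdd (μ t) L) :
    IsPrimOn (fun t => xc (μ t)) (fun s => ∫ z, F (μ s) z ∂(μ s)) 0 T := by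
  refine (S.weak_of_xBdd hT hB (ψ := fun x => x) contDiff_id).congr hT (fun t _ => rfl)
    (fun t _ => ?_)
  unfold rate
  simp

lemma log_expMoment_prim (S : SolCtx ν F A B I M κ γ μ) {T L : ℝ} (hT : 0 ≤ T)
    (hB : ∀ t ∈ Icc 0 T, XBdd (μ t) L) (l : ℝ) :
    IsPrimOn (fun t => Real.log (expMoment (μ t) l))
      (fun s => l * ∫ z, F (μ s) z ∂(tiltX (μ s) l)) 0 T := by
  have h1 := S.weak_of_xBdd hT hB (ψ := fun x => Real.exp (l * x)) (by fun_prop)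
  set m := Real.exp (-(|l| * L))
  have hm : 0 < m := Real.exp_pos _
  have hH : ∀ t ∈ Icc 0 T, ∫ z : ℝ × ℝ, Real.exp (l * z.1) ∂(μ t) ∈ Ici m := fun t ht => by
    have := (S.mem t ht.1).1
    exact (hB t ht).exp_le_expMoment l
  have hL : LipschitzOnWith (Real.toNNReal m⁻¹) Real.log (Ici m) := by
    refine (convex_Ici m).lipschitzOnWith_of_nnnorm_hasDerivWithin_le
      (f' := fun y => y⁻¹) (fun y hy => ?_) (fun y hy => ?_)
    · exact (Real.hasDerivAt_log (hm.trans_le hy).ne').hasDerivWithinAt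
    · rw [← NNReal.coe_le_coe, coe_nnnorm, Real.coe_toNNReal _ (by positivity),
        Real.norm_eq_abs, abs_of_nonneg (inv_nonneg.2 (hm.le.trans hy))]
      exact inv_anti₀ hm hy
  refine (h1.chain_rule hT hH hL
    (φ' := fun t => (∫ z : ℝ × ℝ, Real.exp (l * z.1) ∂(μ t))⁻¹)
    (fun t ht => Real.hasDerivAt_log (hm.trans_le (hH t ht)).ne')).congr hT (fun t _ => rfl)
    (fun t _ => ?_)
  rw [integral_tiltX, mul_left_comm, ← integral_const_mul]
  unfold expMoment rate
  congr 1
  refine integral_congr_ae (Eventually.of_forall fun z => ?_)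
  have hd : deriv (fun x : ℝ => Real.exp (l * x)) z.1 = Real.exp (l * z.1) * l := by
    have := ((hasDerivAt_id' z.1).const_mul l).exp
    rw [mul_one] at this
    exact this.deriv
  simp only [hd]
  ring

lemma softDiam_prim (S : SolCtx ν F A B I M κ γ μ) {T L : ℝ} (hT : 0 ≤ T)
    (hB : ∀ t ∈ Icc 0 T, XBdd (μ t) L) {l : ℝ} (hl : 0 < l) :
    IsPrimOn (fun t => softDiam (μ t) l)
      (fun s => (∫ z, F (μ s) z ∂(tiltX (μ s) l)) - ∫ z, F (μ s) z ∂(tiltX (μ s) (-l))) 0 T := by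
  refine (((S.log_expMoment_prim hT hB l).add
    (S.log_expMoment_prim hT hB (-l))).const_mul l⁻¹).congr hT (fun t _ => ?_) (fun t _ => ?_)
  · unfold softDiam
    rw [div_eq_inv_mul]
  · field_simp
    ring

/-- Finite speed of propagation for the diameter of the support. -/
lemma diamx_le_add (S : SolCtx ν F A B I M κ γ μ) {T L C : ℝ} (hT : 0 ≤ T)
    (hB : ∀ t ∈ Icc 0 T, XBdd (μ t) L)
    (hC : ∀ s ∈ Icc 0 T, ∀ᵐ z ∂(μ s), |F (μ s) z| ≤ C) {a b : ℝ} (ha : 0 ≤ a) (hab : a ≤ b)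
    (hb : b ≤ T) : diamx (μ b) ≤ diamx (μ a) + 2 * C * (b - a) := by
  have := (S.mem a ha).1
  have := (S.mem b (ha.trans hab)).1
  refine le_of_tendsto' (hB b ⟨ha.trans hab, hb⟩).tendsto_softDiam fun n => ?_
  have hn : (0 : ℝ) < (n : ℝ) + 1 := by positivity
  have h1 := ((S.softDiam_prim hT hB hn).mono ha hab hb).sub_eq hab
  have h2 := (hB a ⟨ha, hab.trans hb⟩).softDiam_le_diamx hn
  have h3 := intervalIntegral.norm_integral_le_of_norm_le_const (a := a) (b := b) (C := 2 * C)
    (f := fun s => (∫ z, F (μ s) z ∂(tiltX (μ s) ((n : ℝ) + 1))) -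
      ∫ z, F (μ s) z ∂(tiltX (μ s) (-((n : ℝ) + 1)))) (fun s hs => by
    rw [uIoc_of_le hab] at hs
    have hsT : s ∈ Icc 0 T := ⟨ha.trans hs.1.le, hs.2.trans hb⟩
    have := (S.mem s hsT.1).1
    have h4 : ∀ l, ‖∫ z, F (μ s) z ∂(tiltX (μ s) l)‖ ≤ C := fun l => by
      have := (hB s hsT).isProbabilityMeasure_tiltX l
      simpa using norm_integral_le_of_norm_le_const (f := F (μ s)) (μ := tiltX (μ s) l) (C := C) (ae_tiltX (hC s hsT) l)
    refine (norm_sub_le _ _).trans ?_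
    linarith [h4 ((n : ℝ) + 1), h4 (-((n : ℝ) + 1))])
  rw [← h1, Real.norm_eq_abs, abs_of_nonneg (sub_nonneg.2 hab)] at h3
  linarith [(abs_le.1 h3).2]

end SolCtx

lemma add_C1_le_C2_mul {A I M κ γ D G g V y : ℝ} (hA : 0 < A) (hI : 0 < I) (hM : 0 < M)
    (hκ : 0 < κ) (hγ : 0 < γ) (hD : 0 < D)
    (hparam : 0 < A - ((κ + 1) * I + κ * M) * D - I * γ) (hG : A ≤ G) (hg : |g| ≤ κ * I)
    (hV : |V - G| ≤ ((κ + 1) * I + κ * M) * D + I * γ) (hy : y ∈ Ioo 0 D) :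
    g * y + C1 I M κ γ D ≤ (C2 A I M κ γ D + g / G * y) * V := by
  set R := ((κ + 1) * I + κ * M) * D + I * γ with hR
  have hR0 : 0 < R := by positivity
  have hAR : 0 < A - R := by linarith
  have hG0 : 0 < G := hA.trans_le hG
  have hC1 : 0 ≤ C1 I M κ γ D := by unfold C1; positivity
  have e2 : C2 A I M κ γ D = C1 I M κ γ D / A +
      R * (κ * I * D + C1 I M κ γ D) / (A * (A - R)) := by
    unfold C2
    rw [hR]
    congr 3
    ring
  have hC2 : 0 ≤ C2 A I M κ γ D := by rw [e2]; positivity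
  have e3 : C2 A I M κ γ D * (A - R) = C1 I M κ γ D + R * (κ * I * D) / A := by
    rw [e2]
    field_simp
    ring
  have h1 : C2 A I M κ γ D * (A - R) ≤ C2 A I M κ γ D * V := by
    gcongr
    linarith [(abs_le.1 hV).1]
  have h2 : |g / G * y * (V - G)| ≤ R * (κ * I * D) / A := by
    rw [abs_mul, abs_mul, abs_div, abs_of_pos hG0, abs_of_pos hy.1]
    calc |g| / G * y * |V - G| ≤ κ * I / A * D * R := by
          have := hy.1
          have := hy.2
          gcongr
      _ = _ := by ring
  have h3 : (C2 A I M κ γ D + g / G * y) * V =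
      C2 A I M κ γ D * V + g * y + g / G * y * (V - G) := by
    field_simp
    ring
  rw [h3]
  linarith [(abs_le.1 h2).1]

lemma XBdd.abs_sub_xc_le {μ : Measure (ℝ × ℝ)} [IsProbabilityMeasure μ] {L : ℝ}
    (h : XBdd μ L) {z : ℝ × ℝ} (hz : z ∈ msupp μ) : |z.1 - xc μ| ≤ diamx μ := by
  have hi : Integrable (fun z : ℝ × ℝ => z.1) μ := h.integrable_comp continuous_id
  have h1 := integral_mono_ae (integrable_const (z.1 - diamx μ)) hi (by
    filter_upwards [ae_mem_msupp μ] with z' hz'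
    linarith [sub_le_diamx h.bddAbove hz hz'])
  have h2 := integral_mono_ae hi (integrable_const (z.1 + diamx μ)) (by
    filter_upwards [ae_mem_msupp μ] with z' hz'
    linarith [sub_le_diamx h.bddAbove hz' hz])
  simp only [integral_const, probReal_univ, one_smul] at h1 h2
  unfold xc
  exact abs_le.2 ⟨by linarith, by linarith⟩

lemma XBdd.measurable_diamx_aux {μ : ℝ → Measure (ℝ × ℝ)} {L a b : ℝ}
    (hP : ∀ t ∈ Icc a b, IsProbabilityMeasure (μ t)) (hB : ∀ t ∈ Icc a b, XBdd (μ t) L)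
    (hc : ∀ n : ℕ, ContinuousOn (fun t => softDiam (μ t) (n + 1)) (Icc a b)) :
    AEStronglyMeasurable (fun t => diamx (μ t)) (volume.restrict (Icc a b)) := by
  refine aestronglyMeasurable_of_tendsto_ae atTop
    (fun n => (hc n).aestronglyMeasurable measurableSet_Icc) ?_
  refine (ae_restrict_iff' measurableSet_Icc).2 (Eventually.of_forall fun t ht => ?_)
  have := hP t ht
  exact (hB t ht).tendsto_softDiam

namespace SolCtx

variable {ν : Measure ℝ} {F : Measure (ℝ × ℝ) → ℝ × ℝ → ℝ} {A B I M κ γ : ℝ}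
  {μ : ℝ → Measure (ℝ × ℝ)}

lemma W1_xc_le (S : SolCtx ν F A B I M κ γ μ) {s L D : ℝ} (hs : 0 ≤ s) (hL : XBdd (μ s) L)
    (hd : diamx (μ s) ≤ D) : W1 (μ s) (diracProd (xc (μ s)) ν) ≤ D := by
  have := S.isProb
  have := (S.mem s hs).1
  refine W1_diracProd_le_of_ae (S.mem s hs) ?_
  filter_upwards [ae_mem_msupp (μ s)] with z hz using (hL.abs_sub_xc_le hz).trans hd

lemma abs_mean_velocity_sub_le (S : SolCtx ν F A B I M κ γ μ) {s L D C : ℝ} (hs : 0 ≤ s)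
    (hL : XBdd (μ s) L) (hC : ∀ᵐ z ∂(μ s), |F (μ s) z| ≤ C) (hd : diamx (μ s) ≤ D) :
    |(∫ z, F (μ s) z ∂(μ s)) - F (diracProd (xc (μ s)) ν) (xc (μ s), wc ν)| ≤
      κ * M * D + κ * I * D + I * γ := by
  have := S.isProb
  have := (S.mem s hs).1
  set G := F (diracProd (xc (μ s)) ν) (xc (μ s), wc ν)
  have h1 : ∀ᵐ z ∂(μ s), ‖F (μ s) z - G‖ ≤ κ * M * D + κ * I * D + I * γ := by
    filter_upwards [ae_mem_msupp (μ s), S.ae_snd hs] with z hz hz2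
    exact S.fw.abs_sub_diracProd_le S.bdd S.gamma_eq S.I_pos S.M_pos S.kappa_pos (S.mem s hs)
      (S.W1_xc_le hs hL hd) ((hL.abs_sub_xc_le hz).trans hd) hz2
  have h2 := norm_integral_le_of_norm_le_const h1
  rw [integral_sub (S.integrable_of_ae_bound hs hC Measure.AbsolutelyContinuous.rfl)
    (integrable_const G)] at h2
  simpa using h2

lemma softDiam_rate_le (S : SolCtx ν F A B I M κ γ μ) {s L D C l : ℝ} (hs : 0 ≤ s)
    (hL : XBdd (μ s) L) (hC : ∀ᵐ z ∂(μ s), |F (μ s) z| ≤ C) (hd : diamx (μ s) ≤ D) :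
    (∫ z, F (μ s) z ∂(tiltX (μ s) l)) - ∫ z, F (μ s) z ∂(tiltX (μ s) (-l)) ≤
      Fx F (diracProd (xc (μ s)) ν) (xc (μ s), wc ν) *
        ((∫ z, z.1 ∂(tiltX (μ s) l)) - ∫ z, z.1 ∂(tiltX (μ s) (-l))) + C1 I M κ γ D := by
  have := S.isProb
  have := (S.mem s hs).1
  set g := Fx F (diracProd (xc (μ s)) ν) (xc (μ s), wc ν)
  have hPr := fun k => hL.isProbabilityMeasure_tiltX k
  have hFi : ∀ k, Integrable (F (μ s)) (tiltX (μ s) k) := fun k =>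
    S.integrable_of_ae_bound hs hC (tilted_absolutelyContinuous _ _)
  have hxi : ∀ k, Integrable (fun z : ℝ × ℝ => g * z.1) (tiltX (μ s) k) := fun k =>
    (hL.tiltX_xBdd k).integrable_comp (φ := fun x => g * x) (by fun_prop)
  have hp := ae_mem_msupp (μ s)
  have h1 := integral_le_integral_add (ρ := tiltX (μ s) l) (ρ' := tiltX (μ s) (-l))
    ((hFi l).sub (hxi l)) ((hFi (-l)).sub (hxi (-l)))
    (p := fun z => z ∈ msupp (μ s) ∧ z.2 ∈ msupp ν) (ae_tiltX (hp.and (S.ae_snd hs)) l)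
    (ae_tiltX (hp.and (S.ae_snd hs)) (-l)) (C := C1 I M κ γ D) (fun z hz z' hz' => by
      have h2 := S.fw.abs_pair_sub_le S.bdd S.gamma_eq S.I_pos S.M_pos S.kappa_pos (S.mem s hs)
        (S.W1_xc_le hs hL hd) (x := z.1) (x' := z'.1) (ω := z.2) (ω' := z'.2)
        ((hL.abs_sub_xc_le hz.1).trans hd) ((hL.abs_sub_xc_le hz'.1).trans hd)
        (abs_le'.2 ⟨(sub_le_diamx hL.bddAbove hz.1 hz'.1).trans hd, by
          rw [neg_sub]; exact (sub_le_diamx hL.bddAbove hz'.1 hz.1).trans hd⟩) hz.2 hz'.2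
      have h3 := (abs_le.1 h2).2
      change F (μ s) z - g * z.1 ≤ F (μ s) z' - g * z'.1 + C1 I M κ γ D
      change F (μ s) z - F (μ s) z' - g * (z.1 - z'.1) ≤ _ at h3
      linarith)
  simp only [Pi.sub_apply] at h1
  rw [integral_sub (hFi l) (hxi l), integral_sub (hFi (-l)) (hxi (-l)), integral_const_mul,
    integral_const_mul] at h1
  linarith

end SolCtx

/-- `Δ` takes values in `(0, D)` and solves the barrier equation. -/
structure IsBarrier (ν : Measure ℝ) (F : Measure (ℝ × ℝ) → ℝ × ℝ → ℝ) (A I M κ γ D : ℝ)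
    (Δ : ℝ → ℝ) : Prop where
  param : 0 < A - ((κ + 1) * I + κ * M) * D - I * γ
  mem : ∀ s : ℝ, Δ s ∈ Ioo (0 : ℝ) D
  ode : ∀ s : ℝ, HasDerivAt Δ (C2 A I M κ γ D +
    (Fx F (diracProd s ν) (s, wc ν) / F (diracProd s ν) (s, wc ν)) * Δ s) s

namespace SolCtx

variable {ν : Measure ℝ} {F : Measure (ℝ × ℝ) → ℝ × ℝ → ℝ} {A B I M κ γ D : ℝ}
  {μ : ℝ → Measure (ℝ × ℝ)} {Δ : ℝ → ℝ}

lemma abs_Fx_diracProd_le (S : SolCtx ν F A B I M κ γ μ) (s : ℝ) :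
    |Fx F (diracProd s ν) (s, wc ν)| ≤ κ * I := by
  have := S.isProb
  exact (S.fw.hA2 _ (diracProd_mem S.bdd s)).2.1 _

lemma barrier_lipschitz (S : SolCtx ν F A B I M κ γ μ) (hΔ : IsBarrier ν F A I M κ γ D Δ) :
    ∃ K, LipschitzOnWith K Δ univ := by
  refine ⟨Real.toNNReal (|C2 A I M κ γ D| + κ * I / A * D),
    convex_univ.lipschitzOnWith_of_nnnorm_hasDerivWithin_le
      (fun s _ => (hΔ.ode s).hasDerivWithinAt) fun s _ => ?_⟩
  have hκ := S.kappa_pos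
  have hI := S.I_pos
  have hA := S.A_pos
  have hD : 0 < D := (hΔ.mem 0).1.trans (hΔ.mem 0).2
  rw [← NNReal.coe_le_coe, coe_nnnorm, Real.coe_toNNReal _ (by positivity)]
  refine (norm_add_le _ _).trans ?_
  rw [Real.norm_eq_abs, Real.norm_eq_abs, abs_mul, abs_div, abs_of_pos (hΔ.mem s).1,
    abs_of_pos (S.A_pos.trans_le (S.fw.hA4 s))]
  have h1 := S.abs_Fx_diracProd_le s
  have h2 := S.fw.hA4 s
  have h3 := (hΔ.mem s).1
  have h4 := (hΔ.mem s).2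
  gcongr

lemma barrier_prim (S : SolCtx ν F A B I M κ γ μ) (hΔ : IsBarrier ν F A I M κ γ D Δ) {T L : ℝ}
    (hT : 0 ≤ T) (hB : ∀ t ∈ Icc 0 T, XBdd (μ t) L) :
    IsPrimOn (fun t => Δ (xc (μ t))) (fun t => (C2 A I M κ γ D +
      (Fx F (diracProd (xc (μ t)) ν) (xc (μ t), wc ν) /
        F (diracProd (xc (μ t)) ν) (xc (μ t), wc ν)) * Δ (xc (μ t))) *
        ∫ z, F (μ t) z ∂(μ t)) 0 T := by
  obtain ⟨K, hK⟩ := S.barrier_lipschitz hΔ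
  exact (S.xc_prim hT hB).chain_rule hT (fun _ _ => mem_univ _) hK fun t _ => hΔ.ode _

lemma rate_sub_le (S : SolCtx ν F A B I M κ γ μ) (hΔ : IsBarrier ν F A I M κ γ D Δ)
    {s L C l : ℝ} (hl : 0 < l) (hs : 0 ≤ s) (hL : XBdd (μ s) L)
    (hC : ∀ᵐ z ∂(μ s), |F (μ s) z| ≤ C) (hd : diamx (μ s) ≤ D) :
    (∫ z, F (μ s) z ∂(tiltX (μ s) l)) - (∫ z, F (μ s) z ∂(tiltX (μ s) (-l))) -
      (C2 A I M κ γ D + (Fx F (diracProd (xc (μ s)) ν) (xc (μ s), wc ν) /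
        F (diracProd (xc (μ s)) ν) (xc (μ s), wc ν)) * Δ (xc (μ s))) * ∫ z, F (μ s) z ∂(μ s) ≤
      κ * I * (|diamx (μ s) - Δ (xc (μ s))| + (diamx (μ s) - softDiam (μ s) l)) := by
  have := (S.mem s hs).1
  have hκ := S.kappa_pos
  have hI := S.I_pos
  have hD : 0 < D := (hΔ.mem 0).1.trans (hΔ.mem 0).2
  have h1 := S.softDiam_rate_le (l := l) hs hL hC hd
  have hg := S.abs_Fx_diracProd_le (xc (μ s))
  have h2 := add_C1_le_C2_mul S.A_pos S.I_pos S.M_pos S.kappa_pos S.gamma_pos hD hΔ.param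
    (S.fw.hA4 (xc (μ s))) hg
    ((S.abs_mean_velocity_sub_le hs hL hC hd).trans (by nlinarith [mul_pos hI hD]))
    (hΔ.mem (xc (μ s)))
  have h3 := hL.softDiam_le hl
  have h4 := hL.integral_tiltX_sub_le_diamx l (-l)
  set u := (∫ z, z.1 ∂(tiltX (μ s) l)) - ∫ z, z.1 ∂(tiltX (μ s) (-l))
  set g := Fx F (diracProd (xc (μ s)) ν) (xc (μ s), wc ν)
  set y := Δ (xc (μ s))
  have h5 : |u - y| ≤ |diamx (μ s) - y| + (diamx (μ s) - softDiam (μ s) l) := by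
    have e : u - y = (diamx (μ s) - y) - (diamx (μ s) - u) := by ring
    rw [e]
    refine (abs_sub _ _).trans ?_
    rw [abs_of_nonneg (sub_nonneg.2 h4)]
    linarith
  have h6 : g * (u - y) ≤
      κ * I * (|diamx (μ s) - y| + (diamx (μ s) - softDiam (μ s) l)) := by
    refine (le_abs_self _).trans ?_
    rw [abs_mul]
    gcongr
  linarith

/-- The excess of the diameter over the barrier grows at most at rate `κ I` times its size. -/
lemma excess_le (S : SolCtx ν F A B I M κ γ μ) (hΔ : IsBarrier ν F A I M κ γ D Δ) {T L : ℝ}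
    (hT : 0 ≤ T) (hB : ∀ t ∈ Icc 0 T, XBdd (μ t) L) {a b W : ℝ} (ha : 0 ≤ a) (hab : a ≤ b)
    (hb : b ≤ T) (hd : ∀ t ∈ Ioc a b, diamx (μ t) ≤ D)
    (hW : ∀ t ∈ Ioc a b, |diamx (μ t) - Δ (xc (μ t))| ≤ W) :
    diamx (μ b) - Δ (xc (μ b)) ≤ diamx (μ a) - Δ (xc (μ a)) + κ * I * W * (b - a) := by
  obtain ⟨C, -, hC⟩ := S.exists_velocity_bound hB
  have hκ := S.kappa_pos
  have hI := S.I_pos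
  have hmem : ∀ t ∈ Icc a b, t ∈ Icc 0 T := fun t ht => ⟨ha.trans ht.1, ht.2.trans hb⟩
  have hPr : ∀ t ∈ Icc a b, IsProbabilityMeasure (μ t) := fun t ht => (S.mem t (hmem t ht).1).1
  have hn0 : ∀ n : ℕ, (0 : ℝ) < (n : ℝ) + 1 := fun n => by positivity
  have hprim : ∀ n : ℕ, _ := fun n => (S.softDiam_prim hT hB (hn0 n)).mono ha hab hb
  have hcont : ∀ n : ℕ, ContinuousOn (fun t => softDiam (μ t) (n + 1)) (Icc a b) := fun n =>
    (hprim n).continuousOn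
  have hms : ∀ n : ℕ, AEStronglyMeasurable (fun t => diamx (μ t) - softDiam (μ t) (n + 1))
      (volume.restrict (uIoc a b)) := fun n => by
    rw [uIoc_of_le hab]
    exact ((XBdd.measurable_diamx_aux hPr (fun t ht => hB t (hmem t ht)) hcont).sub
      ((hcont n).aestronglyMeasurable measurableSet_Icc)).mono_measure
        (Measure.restrict_mono Ioc_subset_Icc_self le_rfl)
  have hbd : ∀ n : ℕ, ∀ᵐ t ∂volume, t ∈ uIoc a b →
      ‖diamx (μ t) - softDiam (μ t) (n + 1)‖ ≤ 4 * L := fun n =>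
    Eventually.of_forall fun t ht => by
      rw [uIoc_of_le hab] at ht
      have ht' := Ioc_subset_Icc_self ht
      have := hPr t ht'
      have hX := hB t (hmem t ht')
      rw [Real.norm_eq_abs, abs_of_nonneg (sub_nonneg.2 (hX.softDiam_le_diamx (hn0 n)))]
      linarith [hX.diamx_le_two_mul, hX.neg_le_softDiam (hn0 n)]
  have hei : ∀ n : ℕ, IntervalIntegrable (fun t => diamx (μ t) - softDiam (μ t) (n + 1))
      volume a b := fun n =>
    (intervalIntegrable_const (c := 4 * L)).mono_fun (hms n) (by
      refine (ae_restrict_iff' measurableSet_uIoc).2 ?_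
      filter_upwards [hbd n] with t ht ht'
      exact (ht ht').trans (le_abs_self _))
  have hlim : Tendsto (fun n : ℕ => ∫ t in a..b, (diamx (μ t) - softDiam (μ t) (n + 1))) atTop
      (nhds 0) := by
    have := intervalIntegral.tendsto_integral_filter_of_dominated_convergence (μ := volume)
      (a := a) (b := b) (l := atTop)
      (F := fun (n : ℕ) t => diamx (μ t) - softDiam (μ t) (n + 1)) (f := fun _ => (0 : ℝ))
      (fun _ => 4 * L) (Eventually.of_forall hms) (Eventually.of_forall hbd)
      intervalIntegrable_const (Eventually.of_forall fun t ht => by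
        rw [uIoc_of_le hab] at ht
        have ht' := Ioc_subset_Icc_self ht
        have := hPr t ht'
        simpa using tendsto_const_nhds.sub (hB t (hmem t ht')).tendsto_softDiam
          (a := diamx (μ t)))
    simpa using this
  have hbar := (S.barrier_prim hΔ hT hB).mono ha hab hb
  have hstep : ∀ n : ℕ, softDiam (μ b) (n + 1) - Δ (xc (μ b)) -
      (softDiam (μ a) (n + 1) - Δ (xc (μ a))) ≤
      κ * I * W * (b - a) + κ * I * ∫ t in a..b, (diamx (μ t) - softDiam (μ t) (n + 1)) :=
    fun n => by
    have h1 := ((hprim n).sub hbar).sub_eq hab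
    rw [h1]
    have h2 := intervalIntegral.integral_mono_on_of_le_Ioo hab ((hprim n).sub hbar).1
      (g := fun t => κ * I * W + κ * I * (diamx (μ t) - softDiam (μ t) (n + 1)))
      (intervalIntegrable_const.add ((hei n).const_mul _)) (fun t ht => by
        have ht' := Ioo_subset_Icc_self ht
        refine (S.rate_sub_le hΔ (hn0 n) (hmem t ht').1 (hB t (hmem t ht'))
          (hC t (hmem t ht')) (hd t (Ioo_subset_Ioc_self ht))).trans ?_
        rw [← mul_add]
        gcongr
        exact hW t (Ioo_subset_Ioc_self ht))
    refine h2.trans (le_of_eq ?_)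
    rw [intervalIntegral.integral_add intervalIntegrable_const ((hei n).const_mul _),
      intervalIntegral.integral_const, intervalIntegral.integral_const_mul, smul_eq_mul]
    ring
  have hPa := hPr a ⟨le_rfl, hab⟩
  have hPb := hPr b ⟨hab, le_rfl⟩
  have hta := (hB a (hmem a ⟨le_rfl, hab⟩)).tendsto_softDiam
  have htb := (hB b (hmem b ⟨hab, le_rfl⟩)).tendsto_softDiam
  have := le_of_tendsto_of_tendsto'
    ((htb.sub_const (Δ (xc (μ b)))).sub (hta.sub_const (Δ (xc (μ a)))))
    ((hlim.const_mul (κ * I)).const_add (κ * I * W * (b - a))) hstep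
  linarith

end SolCtx

namespace SolCtx

variable {ν : Measure ℝ} {F : Measure (ℝ × ℝ) → ℝ × ℝ → ℝ} {A B I M κ γ D : ℝ}
  {μ : ℝ → Measure (ℝ × ℝ)} {Δ : ℝ → ℝ}

lemma isClosed_below_barrier (S : SolCtx ν F A B I M κ γ μ) (hΔ : IsBarrier ν F A I M κ γ D Δ)
    {T L : ℝ} (hT : 0 ≤ T) (hB : ∀ t ∈ Icc 0 T, XBdd (μ t) L) :
    IsClosed {t | t ∈ Icc 0 T ∧ diamx (μ t) ≤ Δ (xc (μ t))} := by
  have e : {t | t ∈ Icc 0 T ∧ diamx (μ t) ≤ Δ (xc (μ t))} =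
      ⋂ n : ℕ, {t ∈ Icc 0 T | softDiam (μ t) (n + 1) ≤ Δ (xc (μ t))} := by
    ext t
    rw [mem_iInter]
    constructor
    · rintro ⟨ht, h⟩ n
      have := (S.mem t ht.1).1
      exact ⟨ht, ((hB t ht).softDiam_le_diamx (by positivity)).trans h⟩
    · intro h
      have ht : t ∈ Icc 0 T := (h 0).1
      have := (S.mem t ht.1).1
      exact ⟨ht, le_of_tendsto' (hB t ht).tendsto_softDiam fun n => (h n).2⟩
  rw [e]
  exact isClosed_iInter fun n => isClosed_Icc.isClosed_le
    (S.softDiam_prim hT hB (l := (n : ℝ) + 1) (by positivity)).continuousOn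
    (S.barrier_prim hΔ hT hB).continuousOn

lemma below_barrier_step (S : SolCtx ν F A B I M κ γ μ) (hΔ : IsBarrier ν F A I M κ γ D Δ)
    {T L : ℝ} (hT : 0 ≤ T) (hB : ∀ t ∈ Icc 0 T, XBdd (μ t) L) {a b : ℝ} (ha : 0 ≤ a)
    (hab : a ≤ b) (hb : b ≤ T) (hd : ∀ t ∈ Icc a b, diamx (μ t) ≤ D)
    (hlen : κ * I * (b - a) ≤ 1 / 2) (h0 : diamx (μ a) ≤ Δ (xc (μ a))) :
    diamx (μ b) ≤ Δ (xc (μ b)) := by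
  have hκ := S.kappa_pos
  have hI := S.I_pos
  have hD : 0 < D := (hΔ.mem 0).1.trans (hΔ.mem 0).2
  have hcl := S.isClosed_below_barrier hΔ hT hB
  have key : ∀ n : ℕ, ∀ t ∈ Icc a b, diamx (μ t) - Δ (xc (μ t)) ≤ D * (1 / 2) ^ n := by
    intro n
    induction n with
    | zero =>
      intro t ht
      linarith [hd t ht, (hΔ.mem (xc (μ t))).1]
    | succ n ih =>
      intro t ht
      have hW0 : 0 ≤ D * (1 / 2) ^ n := by positivity
      set Z := {s | s ∈ Icc 0 T ∧ diamx (μ s) ≤ Δ (xc (μ s))} ∩ Icc a t with hZ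
      have hZc : IsCompact Z := isCompact_Icc.inter_left hcl
      have hZa : a ∈ Z := ⟨⟨⟨ha, hab.trans hb⟩, h0⟩, le_rfl, ht.1⟩
      obtain ⟨m, hm, hmax⟩ := hZc.exists_isGreatest ⟨a, hZa⟩
      have hpos : ∀ s ∈ Ioc m t, 0 ≤ diamx (μ s) - Δ (xc (μ s)) := fun s hs => by
        by_contra hneg
        have : s ∈ Z := ⟨⟨⟨hm.1.1.1.trans hs.1.le, hs.2.trans (ht.2.trans hb)⟩, by linarith⟩,
          hm.2.1.trans hs.1.le, hs.2⟩
        exact absurd (hmax this) (not_le.2 hs.1)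
      have h1 := S.excess_le hΔ hT hB (a := m) (b := t) (W := D * (1 / 2) ^ n) hm.1.1.1 hm.2.2
        (ht.2.trans hb) (fun s hs => hd s ⟨hm.2.1.trans hs.1.le, hs.2.trans ht.2⟩)
        (fun s hs => by
          rw [abs_of_nonneg (hpos s hs)]
          exact ih s ⟨hm.2.1.trans hs.1.le, hs.2.trans ht.2⟩)
      have h2 : κ * I * (t - m) ≤ 1 / 2 := by
        refine le_trans ?_ hlen
        gcongr
        · exact ht.2
        · exact hm.2.1
      have h3 := mul_le_mul_of_nonneg_right h2 hW0
      have h4 := hm.1.2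
      rw [pow_succ]
      linarith
  have hlim : Tendsto (fun n : ℕ => D * (1 / 2 : ℝ) ^ n) atTop (nhds 0) := by
    simpa using (tendsto_pow_atTop_nhds_zero_of_lt_one (r := (1 / 2 : ℝ)) (by norm_num)
      (by norm_num)).const_mul D
  linarith [ge_of_tendsto' hlim fun n => key n b ⟨hab, le_rfl⟩]

lemma diamx_le_barrier (S : SolCtx ν F A B I M κ γ μ) (hΔ : IsBarrier ν F A I M κ γ D Δ)
    {T L : ℝ} (hT : 0 ≤ T) (hB : ∀ t ∈ Icc 0 T, XBdd (μ t) L)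
    (h0 : diamx (μ 0) ≤ Δ (xc (μ 0))) : diamx (μ T) ≤ Δ (xc (μ T)) := by
  obtain ⟨C, hC0, hC⟩ := S.exists_velocity_bound hB
  have hκ := S.kappa_pos
  have hI := S.I_pos
  have hcl := S.isClosed_below_barrier hΔ hT hB
  refine ((hcl.inter isClosed_Icc).Icc_subset_of_forall_exists_gt (a := 0) (b := T)
    ⟨⟨le_rfl, hT⟩, h0⟩ ?_ ⟨hT, le_rfl⟩).2
  rintro x ⟨⟨hx, hdx⟩, hx'⟩ y hy
  have hgap := (hΔ.mem (xc (μ x))).2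
  set δ := min ((D - Δ (xc (μ x))) / (2 * C + 1)) (1 / (2 * (κ * I))) with hδ
  have hδ0 : 0 < δ := lt_min (div_pos (by linarith) (by positivity)) (by positivity)
  have hδ1 : δ * (2 * C + 1) ≤ D - Δ (xc (μ x)) :=
    (le_div_iff₀ (by positivity)).1 (min_le_left _ _)
  have hδ2 : δ * (2 * (κ * I)) ≤ 1 := (le_div_iff₀ (by positivity)).1 (min_le_right _ _)
  set z := min (x + δ) (min y T) with hz
  have hxz : x < z := lt_min (by linarith) (lt_min hy hx'.2)
  have hzδ : z ≤ x + δ := min_le_left _ _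
  have hzT : z ≤ T := (min_le_right _ _).trans (min_le_right _ _)
  have hzy : z ≤ y := (min_le_right _ _).trans (min_le_left _ _)
  refine ⟨z, ⟨⟨hx.1.trans hxz.le, hzT⟩, ?_⟩, hxz, hzy⟩
  refine S.below_barrier_step hΔ hT hB hx.1 hxz.le hzT (fun t ht => ?_) ?_ hdx
  · have h1 := S.diamx_le_add hT hB hC hx.1 ht.1 (ht.2.trans hzT)
    have h2 : 2 * C * (t - x) ≤ 2 * C * δ := by
      gcongr
      linarith [ht.2]
    nlinarith
  · have : κ * I * (z - x) ≤ κ * I * δ := by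
      gcongr
      linarith
    linarith

end SolCtx

/-- Positive invariance of `C_ν^{(1)}(Δ)`: under the parameter
conditions `A − ((κ+1)I+κM)D − Iγ > 0` and `2π C₂(κ,γ,D) exp(2πκI/A)/(κB) ≤ D`, if
`Δ : ℝ → (0,D)` is the (unique) `2π`-periodic solution of
`dΔ/ds = C₂(κ,γ,D) + (∂ₛF[δ_s⊗ν](s,ω_c)/F[δ_s⊗ν](s,ω_c)) Δ(s)`, then any
measure-valued solution starting in `C_ν^{(1)}(Δ)` satisfies
`diamₓ(supp μ_t) ≤ Δ(x_c[μ_t]) ≤ D` for all `t ≥ 0`. -/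
theorem invariance_C1
    (ν : Measure ℝ) [IsProbabilityMeasure ν]
    (hΩ : Bornology.IsBounded (msupp ν))
    (A B I M κ γ : ℝ)
    (hpos : 0 < A ∧ 0 < B ∧ 0 < I ∧ 0 < M ∧ 0 < κ ∧ 0 < γ)
    (hγ : γ = sSup {d : ℝ | ∃ ω ∈ msupp ν, ∃ ω' ∈ msupp ν, d = |ω - ω'|})
    (F : Measure (ℝ × ℝ) → ℝ × ℝ → ℝ) (hF : Framework ν F A B I M κ γ)
    (D : ℝ) (hD : 0 < D)
    (hparam : 0 < A - ((κ + 1) * I + κ * M) * D - I * γ)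
    (hDcond : 2 * π * C2 A I M κ γ D * Real.exp (2 * π * κ * I / A) / (κ * B) ≤ D)
    (Δ : ℝ → ℝ)
    (hΔmem : ∀ s : ℝ, Δ s ∈ Ioo (0:ℝ) D)
    (hΔper : ∀ s : ℝ, Δ (s + 2 * π) = Δ s)
    (hΔode : ∀ s : ℝ, HasDerivAt Δ
      (C2 A I M κ γ D +
        (Fx F (diracProd s ν) (s, wc ν) / F (diracProd s ν) (s, wc ν)) * Δ s) s)
    (μ : ℝ → Measure (ℝ × ℝ)) (hsol : IsSol F μ)
    (hP : ∀ t : ℝ, 0 ≤ t → μ t ∈ P2nu ν)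
    (h0 : MemC1 ν Δ (μ 0)) :
    ∀ t : ℝ, 0 ≤ t → MemC1 ν Δ (μ t) ∧ diamx (μ t) ≤ Δ (xc (μ t)) ∧
      Δ (xc (μ t)) ≤ D := by
  obtain ⟨hA, -, hI, hM, hκ, hγ0⟩ := hpos
  have S : SolCtx ν F A B I M κ γ μ :=
    ⟨inferInstance, hΩ, hγ, hA, hI, hM, hκ, hγ0, hF, hsol, hP⟩
  have hΔ : IsBarrier ν F A I M κ γ D Δ := ⟨hparam, hΔmem, hΔode⟩
  intro t ht
  have key : diamx (μ t) ≤ Δ (xc (μ t)) := by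
    by_cases hb : BddAbove (xDists (μ t))
    · have := (hP t ht).1
      obtain ⟨L, hL⟩ := exists_XBdd_of_bddAbove hb
      obtain ⟨L', hL'⟩ := S.exists_uniform_bound (T := t) ⟨ht, le_rfl⟩ hL
      exact S.diamx_le_barrier hΔ ht hL' h0.2
    · rw [diamx_eq_zero hb]
      exact (hΔmem _).1.le
  exact ⟨⟨hP t ht, key⟩, key, (hΔmem _).2.le⟩
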